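/- arXiv:2211.07020 — 3 statements merged into one kernel-verified Lean document; each statement's English description precedes it below -/
import Mathlib

section
/- Let G be a simple graph on [n] and T a spanning forest of G. Then the iterated initial ideal of I_{n-1}(X_G) with respect to the weight vectors w_G, then w_T, then w_diag equals the squarefree monomial ideal I_T|_{Z=0} ⊆ R, obtained from I_T by substituting 0 for all variables in Z; explicitly, I_T|_{Z=0} is generated by the monomials (x_{11}⋯x_{nn})/x_{ii} for i = 1,…,n together with the monomials (∏_{i ∈ [n]∖V(p)} x_{ii})·x_p for all paths p in T. That is, in_{w_diag}(in_{w_T}(in_{w_G}(I_{n-1}(X_G)))) = I_T|_{Z=0}. -/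
open MvPolynomial
open scoped Classical

/-- The polynomial ring `R = K[x_{ij} : 1 ≤ i ≤ j ≤ n]`, realized as the multivariate
polynomial ring whose variables are indexed by unordered pairs of elements of `Fin n`
(so that `x_{ij} = x_{ji}` automatically). -/
abbrev SymPolyRing (K : Type*) [Field K] (n : ℕ) := MvPolynomial (Sym2 (Fin n)) K


/-- The sparse generic symmetric `n × n` matrix `X_G` associated to a simple graph `G`
on `[n]`: its `(i,j)` entry is the variable `x_{ij}` if `i = j` or `ij` is an edge of `G`,
and `0` otherwise (i.e. all variables in `Z` are replaced by `0`). -/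
noncomputable def sparseGenericSym (K : Type*) [Field K] (n : ℕ) (G : SimpleGraph (Fin n)) :
    Matrix (Fin n) (Fin n) (SymPolyRing K n) :=
  fun i j => if i = j ∨ G.Adj i j then MvPolynomial.X s(i, j) else 0


/-- The ideal of `k × k` minors of a square matrix `M` over a commutative ring: it is
generated by the determinants of all `k × k` submatrices of `M` (given by choosing `k`
distinct rows and `k` distinct columns). -/
noncomputable def minorsIdeal {R : Type*} [CommRing R] {n : ℕ} (k : ℕ)
    (M : Matrix (Fin n) (Fin n) R) : Ideal R :=
  Ideal.span { d | ∃ f g : Fin k → Fin n,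
    Function.Injective f ∧ Function.Injective g ∧ d = (M.submatrix f g).det }

/-- The weight of a monomial (exponent vector) `m` with respect to a weight vector `w`. -/
def monWeight {σ : Type*} (w : σ → ℕ) (m : σ →₀ ℕ) : ℕ :=
  m.sum fun s e => e * w s

/-- The maximal `w`-weight of a monomial occurring in the polynomial `f`. -/
noncomputable def topWeight {σ : Type*} {K : Type*} [Field K] (w : σ → ℕ)
    (f : MvPolynomial σ K) : ℕ :=
  f.support.sup (monWeight w)

/-- The initial form `in_w(f)` of a polynomial `f` with respect to a weight vector `w`:
the sum of all terms of `f` of maximal `w`-weight. -/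
noncomputable def initialForm {σ : Type*} {K : Type*} [Field K] (w : σ → ℕ)
    (f : MvPolynomial σ K) : MvPolynomial σ K :=
  ∑ m ∈ f.support.filter (fun m => monWeight w m = topWeight w f),
    MvPolynomial.monomial m (MvPolynomial.coeff m f)

/-- The initial ideal `in_w(J)` of an ideal `J` with respect to a weight vector `w`:
the ideal generated by the initial forms of the nonzero elements of `J`. -/
noncomputable def initialIdeal {σ : Type*} {K : Type*} [Field K] (w : σ → ℕ)
    (J : Ideal (MvPolynomial σ K)) : Ideal (MvPolynomial σ K) :=
  Ideal.span { g | ∃ f ∈ J, f ≠ 0 ∧ g = initialForm w f }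

/-- The weight vector `w_H` attached to a graph `H` on `[n]`: diagonal variables and
variables corresponding to edges of `H` get weight `2`, all other (off-diagonal)
variables get weight `1`. -/
noncomputable def graphWeight {n : ℕ} (H : SimpleGraph (Fin n)) : Sym2 (Fin n) → ℕ :=
  fun e => if e.IsDiag ∨ e ∈ H.edgeSet then 2 else 1

/-- The weight vector `w_diag`: diagonal variables get weight `2`, off-diagonal
variables get weight `1`. -/
noncomputable def diagWeight (n : ℕ) : Sym2 (Fin n) → ℕ :=
  fun e => if e.IsDiag then 2 else 1

/-- The monomial `(∏_{i ∈ [n]∖V(p)} x_{ii}) · x_p` associated to a path `p`, where `V(p)`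
is the vertex set of `p` and `x_p = ∏_{ij ∈ p} x_{ij}`. -/
noncomputable def pathGenerator {K : Type*} [Field K] {n : ℕ} {T : SimpleGraph (Fin n)}
    {k l : Fin n} (p : T.Walk k l) : SymPolyRing K n :=
  (∏ i ∈ Finset.univ \ p.support.toFinset, MvPolynomial.X s(i, i)) *
    (p.edges.map fun e => (MvPolynomial.X e : SymPolyRing K n)).prod

/-- The squarefree monomial ideal `I_T|_{Z=0}`, generated by the monomials
`(x_{11}⋯x_{nn})/x_{ii}` for `i = 1,…,n` together with the monomials
`(∏_{i ∈ [n]∖V(p)} x_{ii}) · x_p` for all paths `p` in `T` (a path having at least one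
edge and no repeated vertex). -/
noncomputable def forestIdealZ (K : Type*) [Field K] (n : ℕ) (T : SimpleGraph (Fin n)) :
    Ideal (SymPolyRing K n) :=
  Ideal.span { m : SymPolyRing K n |
    (∃ i : Fin n, m = ∏ j ∈ Finset.univ.erase i, MvPolynomial.X s(j, j)) ∨
    (∃ (k l : Fin n) (p : T.Walk k l), p.IsPath ∧ k ≠ l ∧ m = pathGenerator p) }



namespace SparseSym

section Init
variable {σ : Type*} {K : Type*} [Field K]

lemma monWeight_eq (w : σ → ℕ) (m : σ →₀ ℕ) : monWeight w m = Finsupp.weight w m := by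
  simp [monWeight, Finsupp.weight_apply]

lemma monWeight_add (w : σ → ℕ) (m m' : σ →₀ ℕ) :
    monWeight w (m + m') = monWeight w m + monWeight w m' := by
  simp [monWeight_eq]

lemma monWeight_single (w : σ → ℕ) (e : σ) :
    monWeight w (Finsupp.single e 1) = w e := by
  simp [monWeight]

lemma coeff_initialForm (w : σ → ℕ) (f : MvPolynomial σ K) (m : σ →₀ ℕ) :
    coeff m (initialForm w f) = if monWeight w m = topWeight w f then coeff m f else 0 := by
  unfold initialForm
  rw [coeff_sum]
  simp only [coeff_monomial]
  rw [Finset.sum_ite_eq']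
  by_cases h : monWeight w m = topWeight w f
  · by_cases hm : coeff m f = 0
    · simp [h, hm]
    · simp [h, hm]
  · simp [h]

lemma le_topWeight (w : σ → ℕ) (f : MvPolynomial σ K) (m : σ →₀ ℕ) (h : coeff m f ≠ 0) :
    monWeight w m ≤ topWeight w f :=
  Finset.le_sup (f := monWeight w) (mem_support_iff.2 h)

lemma topWeight_eq (w : σ → ℕ) (f : MvPolynomial σ K) (d : ℕ)
    (h1 : ∀ m, coeff m f ≠ 0 → monWeight w m ≤ d)
    (h2 : ∃ m, coeff m f ≠ 0 ∧ monWeight w m = d) : topWeight w f = d := by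
  apply le_antisymm
  · exact Finset.sup_le fun m hm => h1 m (mem_support_iff.1 hm)
  · obtain ⟨m, hm, rfl⟩ := h2
    exact le_topWeight w f m hm

lemma exists_topWeight (w : σ → ℕ) (f : MvPolynomial σ K) (hf : f ≠ 0) :
    ∃ m, coeff m f ≠ 0 ∧ monWeight w m = topWeight w f := by
  have hne : f.support.Nonempty := by
    rw [Finset.nonempty_iff_ne_empty]; simpa using hf
  obtain ⟨m, hm, h⟩ := Finset.exists_mem_eq_sup f.support hne (monWeight w)
  exact ⟨m, mem_support_iff.1 hm, h.symm⟩

lemma initialForm_monomial_mul (w : σ → ℕ) (f : MvPolynomial σ K) (u : σ →₀ ℕ) (c : K)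
    (hc : c ≠ 0) :
    initialForm w (monomial u c * f) = monomial u c * initialForm w f := by
  by_cases hf : f = 0
  · subst hf
    simp [initialForm]
  have htop : topWeight w (monomial u c * f) = monWeight w u + topWeight w f := by
    apply topWeight_eq
    · intro m hm
      rw [coeff_monomial_mul'] at hm
      split_ifs at hm with hle
      · have h1 := le_topWeight w f (m - u) (right_ne_zero_of_mul hm)
        have h2 : monWeight w m = monWeight w u + monWeight w (m - u) := by
          rw [← monWeight_add, add_tsub_cancel_of_le hle]
        omega
      · exact absurd rfl hm
    · obtain ⟨m, hm, h⟩ := exists_topWeight w f hf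
      refine ⟨u + m, ?_, ?_⟩
      · rw [coeff_monomial_mul]
        exact mul_ne_zero hc hm
      · rw [monWeight_add, h]
  ext m
  rw [coeff_initialForm, htop, coeff_monomial_mul', coeff_monomial_mul']
  by_cases hle : u ≤ m
  · have h2 : monWeight w m = monWeight w u + monWeight w (m - u) := by
      rw [← monWeight_add, add_tsub_cancel_of_le hle]
    simp only [hle, if_true, coeff_initialForm, h2]
    by_cases h : monWeight w (m - u) = topWeight w f
    · simp [h]
    · simp [h]
  · simp [hle]

/-- If the initial forms of a family are linearly independent, then the initial form of any
nonzero combination is a combination of them. -/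
lemma initialForm_lc {ι : Type*} (w : σ → ℕ) (g : ι → MvPolynomial σ K)
    (hli : LinearIndependent K (fun a => initialForm w (g a))) (c : ι →₀ K) (hc : c ≠ 0) :
    Finsupp.linearCombination K g c ≠ 0 ∧
    initialForm w (Finsupp.linearCombination K g c) ∈
      Submodule.span K (Set.range fun a => initialForm w (g a)) := by
  have hne : c.support.Nonempty := by
    rw [Finset.nonempty_iff_ne_empty]; simpa using hc
  obtain ⟨a0, ha0, hd⟩ := Finset.exists_mem_eq_sup c.support hne (fun a => topWeight w (g a))
  set δ := c.support.sup (fun a => topWeight w (g a)) with hδ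
  have hle : ∀ a ∈ c.support, topWeight w (g a) ≤ δ := fun a ha =>
    Finset.le_sup (f := fun a => topWeight w (g a)) ha
  set f := Finsupp.linearCombination K g c with hf
  have hcf : ∀ m, coeff m f = ∑ a ∈ c.support, c a * coeff m (g a) := by
    intro m
    rw [hf, Finsupp.linearCombination_apply, Finsupp.sum, coeff_sum]
    simp
  set c' : ι →₀ K := c.filter (fun a => topWeight w (g a) = δ) with hc'
  have hc'ne : c' ≠ 0 := by
    intro h0
    have := DFunLike.congr_fun h0 a0
    rw [hc', Finsupp.filter_apply, if_pos hd.symm] at this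
    exact (Finsupp.mem_support_iff.1 ha0) this
  set F := Finsupp.linearCombination K (fun a => initialForm w (g a)) c' with hF
  have hFne : F ≠ 0 := by
    intro h0
    exact hc'ne ((linearIndependent_iff.1 hli) c' h0)
  have hFc : ∀ m, coeff m F = if monWeight w m = δ then coeff m f else 0 := by
    intro m
    have : coeff m F = ∑ a ∈ c.support, c' a * coeff m (initialForm w (g a)) := by
      rw [hF, Finsupp.linearCombination_apply, Finsupp.sum_of_support_subset (s := c.support),
        coeff_sum]
      · simp
      · rw [hc', Finsupp.support_filter]; exact Finset.filter_subset _ _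
      · simp
    rw [this, hcf]
    split_ifs with h
    · apply Finset.sum_congr rfl
      intro a ha
      rw [coeff_initialForm, hc', Finsupp.filter_apply, h]
      by_cases h2 : topWeight w (g a) = δ
      · simp [h2]
      · have : coeff m (g a) = 0 := by
          by_contra h3
          have := le_topWeight w (g a) m h3
          have := hle a ha
          omega
        simp [h2, this]
    · apply Finset.sum_eq_zero
      intro a ha
      rw [coeff_initialForm, hc', Finsupp.filter_apply]
      by_cases h2 : topWeight w (g a) = δ
      · simp [h2, h]
      · simp [h2]
  obtain ⟨m0, hm0⟩ := MvPolynomial.ne_zero_iff.1 hFne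
  have hm0' : monWeight w m0 = δ ∧ coeff m0 f ≠ 0 := by
    rw [hFc] at hm0
    split_ifs at hm0 with h
    · exact ⟨h, hm0⟩
    · exact absurd rfl hm0
  have htop : topWeight w f = δ := by
    apply topWeight_eq
    · intro m hm
      rw [hcf] at hm
      obtain ⟨a, ha, hna⟩ := Finset.exists_ne_zero_of_sum_ne_zero hm
      exact (le_topWeight w (g a) m (right_ne_zero_of_mul hna)).trans (hle a ha)
    · exact ⟨m0, hm0'.2, hm0'.1⟩
  refine ⟨MvPolynomial.ne_zero_iff.2 ⟨m0, hm0'.2⟩, ?_⟩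
  have : initialForm w f = F := by
    ext m
    rw [coeff_initialForm, htop, hFc]
  rw [this, hF, ← Finsupp.range_linearCombination]
  exact ⟨c', rfl⟩

lemma linearIndependent_of_initialForm {ι : Type*} (w : σ → ℕ) (g : ι → MvPolynomial σ K)
    (hli : LinearIndependent K (fun a => initialForm w (g a))) : LinearIndependent K g := by
  rw [linearIndependent_iff]
  intro c hc
  by_contra h
  exact (initialForm_lc w g hli c h).1 hc

lemma mul_mem_of_monomial_mul_mem (V : Submodule K (MvPolynomial σ K)) (f : MvPolynomial σ K)
    (h : ∀ u, monomial u (1 : K) * f ∈ V) (q : MvPolynomial σ K) : q * f ∈ V := by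
  induction q using MvPolynomial.induction_on' with
  | monomial u a =>
    have : monomial u a * f = a • (monomial u (1 : K) * f) := by
      rw [← smul_mul_assoc, smul_monomial]; simp
    rw [this]
    exact V.smul_mem _ (h u)
  | add p q hp hq => rw [add_mul]; exact V.add_mem hp hq

lemma initialIdeal_le {ι : Type*} (w : σ → ℕ) (g : ι → MvPolynomial σ K)
    (hli : LinearIndependent K (fun a => initialForm w (g a)))
    (J : Ideal (MvPolynomial σ K)) (hJ : ∀ f ∈ J, f ∈ Submodule.span K (Set.range g)) :
    ∀ f ∈ initialIdeal w J, f ∈ Submodule.span K (Set.range fun a => initialForm w (g a)) := by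
  intro f hf
  set V := Submodule.span K (Set.range fun a => initialForm w (g a))
  suffices H : ∀ q, q * f ∈ V by simpa using H 1
  unfold initialIdeal at hf
  induction hf using Submodule.span_induction with
  | mem x hx =>
    obtain ⟨f, hfJ, hf0, rfl⟩ := hx
    apply mul_mem_of_monomial_mul_mem
    intro u
    rw [← initialForm_monomial_mul w f u 1 one_ne_zero]
    have h1 : monomial u (1 : K) * f ∈ J := J.mul_mem_left _ hfJ
    have h2 := hJ _ h1
    rw [← Finsupp.range_linearCombination] at h2
    obtain ⟨c, hc⟩ := h2
    rw [← hc]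
    apply (initialForm_lc w g hli c _).2
    rintro rfl
    rw [map_zero] at hc
    rcases mul_eq_zero.1 hc.symm with h | h
    · simp at h
    · exact hf0 h
  | zero => intro q; simp
  | add x y _ _ hx hy => intro q; rw [mul_add]; exact V.add_mem (hx q) (hy q)
  | smul a x _ hx => intro q; rw [smul_eq_mul, ← mul_assoc]; exact hx _

lemma initialForm_mem {w : σ → ℕ} {J : Ideal (MvPolynomial σ K)} {f : MvPolynomial σ K}
    (hf : f ∈ J) (h0 : f ≠ 0) : initialForm w f ∈ initialIdeal w J :=
  Ideal.subset_span ⟨f, hf, h0, rfl⟩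

lemma initialForm_ne_zero (w : σ → ℕ) {f : MvPolynomial σ K} (h0 : f ≠ 0) :
    initialForm w f ≠ 0 := by
  obtain ⟨m, hm, h⟩ := exists_topWeight w f h0
  refine MvPolynomial.ne_zero_iff.2 ⟨m, ?_⟩
  rw [coeff_initialForm, if_pos h]
  exact hm

end Init

section Graph
variable {n : ℕ} {T : SimpleGraph (Fin n)}

/-- Exponent vector of the path generator. -/
noncomputable def pexp {i j : Fin n} (p : T.Walk i j) : Sym2 (Fin n) →₀ ℕ :=
  (∑ v ∈ Finset.univ \ p.support.toFinset, Finsupp.single s(v, v) 1) +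
    (p.edges.map fun e => Finsupp.single e 1).sum

lemma monomial_pexp (K : Type*) [Field K] {i j : Fin n} (p : T.Walk i j) :
    monomial (pexp p) (1 : K) = pathGenerator p := by
  unfold pexp pathGenerator
  have h1 : ∀ s : Finset (Fin n), monomial (∑ v ∈ s, Finsupp.single s(v, v) 1) (1 : K) =
      ∏ v ∈ s, X s(v, v) := by
    intro s
    rw [monomial_sum_one]; rfl
  have h2 : ∀ l : List (Sym2 (Fin n)),
      monomial (l.map fun e => Finsupp.single e 1).sum (1 : K) =
      (l.map fun e => (X e : MvPolynomial (Sym2 (Fin n)) K)).prod := by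
    intro l
    induction l with
    | nil => simp
    | cons a l ih =>
      rw [List.map_cons, List.map_cons, List.sum_cons, List.prod_cons, ← ih, X, monomial_mul,
        one_mul]
  rw [← h1, ← h2, monomial_mul, one_mul]

lemma pexp_cons {i k j : Fin n} (h : T.Adj i k) (p : T.Walk k j) (hp : i ∉ p.support) :
    pexp (SimpleGraph.Walk.cons h p) + Finsupp.single s(i, i) 1 =
      pexp p + Finsupp.single s(i, k) 1 := by
  unfold pexp
  have h1 : Finset.univ \ p.support.toFinset =
      insert i (Finset.univ \ (SimpleGraph.Walk.cons h p).support.toFinset) := by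
    ext v
    simp only [Finset.mem_sdiff, Finset.mem_univ, true_and, List.mem_toFinset, Finset.mem_insert,
      SimpleGraph.Walk.support_cons, List.mem_cons, not_or]
    constructor
    · intro hv
      by_cases hvi : v = i
      · exact Or.inl hvi
      · exact Or.inr ⟨hvi, hv⟩
    · rintro (rfl | hv)
      · exact hp
      · exact hv.2
  rw [h1, Finset.sum_insert (by simp)]
  simp only [SimpleGraph.Walk.edges_cons, List.map_cons, List.sum_cons]
  abel

lemma pexp_reverse {i j : Fin n} (p : T.Walk i j) : pexp p.reverse = pexp p := by
  unfold pexp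
  rw [SimpleGraph.Walk.support_reverse, SimpleGraph.Walk.edges_reverse, List.map_reverse,
    List.sum_reverse]
  simp

lemma pexp_nil (i : Fin n) : pexp (SimpleGraph.Walk.nil : T.Walk i i) =
    ∑ v ∈ Finset.univ.erase i, Finsupp.single s(v, v) 1 := by
  unfold pexp
  simp [Finset.sdiff_singleton_eq_erase]

lemma pexp_diag {i j : Fin n} (p : T.Walk i j) (v : Fin n) :
    pexp p s(v, v) = if v ∈ p.support then 0 else 1 := by
  unfold pexp
  have h2 : ∀ l : List (Sym2 (Fin n)), (∀ e ∈ l, e ∈ T.edgeSet) →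
      (l.map fun e => (Finsupp.single e 1 : Sym2 (Fin n) →₀ ℕ)).sum s(v, v) = 0 := by
    intro l hl
    induction l with
    | nil => simp
    | cons a l ih =>
      rw [List.map_cons, List.sum_cons, Finsupp.add_apply,
        ih (fun e he => hl e (List.mem_cons_of_mem _ he)), add_zero, Finsupp.single_apply,
        if_neg]
      rintro rfl
      simpa using hl _ List.mem_cons_self
  rw [Finsupp.add_apply, h2 _ (fun e he => p.edges_subset_edgeSet he), add_zero,
    Finsupp.finset_sum_apply]
  have h3 : ∀ u : Fin n, (Finsupp.single s(u, u) 1 : Sym2 (Fin n) →₀ ℕ) s(v, v) =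
      if u = v then 1 else 0 := by
    intro u
    rw [Finsupp.single_apply]
    simp
  simp only [h3, Finset.sum_ite_eq']
  by_cases hv : v ∈ p.support <;> simp [hv]

/-- The combined weight: diagonal `n+1`, tree edges `n`, others `0`. -/
noncomputable def cw (T : SimpleGraph (Fin n)) : Sym2 (Fin n) → ℕ :=
  fun e => if e.IsDiag then n + 1 else if e ∈ T.edgeSet then n else 0

lemma cw_diag (v : Fin n) : cw T s(v, v) = n + 1 := by simp [cw]

lemma cw_adj {u v : Fin n} (h : T.Adj u v) : cw T s(u, v) = n := by
  simp [cw, h.ne, h]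

lemma cw_not {u v : Fin n} (h : u ≠ v) (h' : ¬ T.Adj u v) : cw T s(u, v) = 0 := by
  simp [cw, h, h']

lemma cw_rel (m : Sym2 (Fin n) →₀ ℕ) :
    monWeight (cw T) m + (n + 1) * monWeight (fun _ => 1) m =
      monWeight (diagWeight n) m + n * monWeight (graphWeight T) m := by
  simp only [monWeight, Finsupp.sum, Finset.mul_sum, ← Finset.sum_add_distrib]
  apply Finset.sum_congr rfl
  intro e _
  unfold cw diagWeight graphWeight
  by_cases h1 : e.IsDiag <;> by_cases h2 : e ∈ T.edgeSet <;> simp [h1, h2] <;> ring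

lemma graphWeight_le (m : Sym2 (Fin n) →₀ ℕ) :
    monWeight (graphWeight T) m ≤ 2 * monWeight (fun _ => 1) m := by
  simp only [monWeight, Finsupp.sum, Finset.mul_sum]
  apply Finset.sum_le_sum
  intro e _
  have : graphWeight T e ≤ 2 := by unfold graphWeight; split_ifs <;> omega
  nlinarith

lemma weight_pexp (w : Sym2 (Fin n) → ℕ) (D t : ℕ) (hD : ∀ v, w s(v, v) = D)
    (ht : ∀ u v, T.Adj u v → w s(u, v) = t) {i j : Fin n} (p : T.Walk i j) (hp : p.IsPath) :
    monWeight w (pexp p) + (p.length + 1) * D = n * D + p.length * t := by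
  induction p with
  | nil =>
    rename_i u
    rw [pexp_nil, monWeight_eq, map_sum]
    simp only [← monWeight_eq, monWeight_single, hD]
    rw [Finset.sum_const, Finset.card_erase_of_mem (Finset.mem_univ _), Finset.card_univ,
      Fintype.card_fin]
    have : 0 < n := u.pos
    obtain ⟨m, rfl⟩ : ∃ m, n = m + 1 := ⟨n - 1, by omega⟩
    simp
    ring
  | cons h p ih =>
    rename_i u v _
    rw [SimpleGraph.Walk.cons_isPath_iff] at hp
    have h1 := ih hp.1
    have h2 := congrArg (monWeight w) (pexp_cons h p hp.2)
    rw [monWeight_add, monWeight_add, monWeight_single, monWeight_single, hD, ht _ _ h] at h2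
    rw [SimpleGraph.Walk.length_cons]
    nlinarith

lemma cw_pexp {i j : Fin n} (p : T.Walk i j) (hp : p.IsPath) :
    monWeight (cw T) (pexp p) + p.length + (n + 1) = n * (n + 1) := by
  have := weight_pexp (cw T) (n + 1) n cw_diag (fun u v h => cw_adj h) p hp
  nlinarith

lemma gw_pexp {i j : Fin n} (p : T.Walk i j) (hp : p.IsPath) :
    monWeight (graphWeight T) (pexp p) + 2 = 2 * n := by
  have := weight_pexp (graphWeight T) 2 2 (by simp [graphWeight])
    (by intro u v h; simp [graphWeight, h]) p hp
  omega

lemma path_eq (hT : T.IsAcyclic) {i j : Fin n} (p q : T.Walk i j) (hp : p.IsPath)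
    (hq : q.IsPath) : p = q :=
  congrArg Subtype.val (hT.path_unique ⟨p, hp⟩ ⟨q, hq⟩)

/-- A `T`-neighbour of the start of a path is the second vertex or off the path. -/
lemma nbr_off_path (hT : T.IsAcyclic) {i i' j k : Fin n} (h : T.Adj i i') (p : T.Walk i' j)
    (hp : (SimpleGraph.Walk.cons h p).IsPath) (hk : T.Adj i k) (hne : k ≠ i') :
    k ∉ (SimpleGraph.Walk.cons h p).support := by
  intro hmem
  rw [SimpleGraph.Walk.support_cons, List.mem_cons] at hmem
  rcases hmem with rfl | hmem
  · exact hk.ne rfl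
  · rw [SimpleGraph.Walk.cons_isPath_iff] at hp
    have hq : (SimpleGraph.Walk.cons hk (p.dropUntil k hmem)).IsPath := by
      rw [SimpleGraph.Walk.cons_isPath_iff]
      exact ⟨hp.1.dropUntil hmem, fun hh => hp.2 (p.support_dropUntil_subset hmem hh)⟩
    have := path_eq hT _ _ hq ((SimpleGraph.Walk.cons_isPath_iff h p).2 hp)
    injection this with h1 h2
    exact hne (by assumption)

lemma path_sub (hT : T.IsAcyclic) {i j k l : Fin n} (p : T.Walk i j) (q : T.Walk k l)
    (hp : p.IsPath) (hq : q.IsPath) (hi : i ∈ q.support) (hj : j ∈ q.support) :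
    p.length ≤ q.length ∧ (p.length = q.length → (i = k ∧ j = l) ∨ (i = l ∧ j = k)) := by
  have hspec := q.take_spec hi
  have hlen : (q.takeUntil i hi).length + (q.dropUntil i hi).length = q.length := by
    rw [← SimpleGraph.Walk.length_append, hspec]
  have hj' : j ∈ (q.takeUntil i hi).support ∨ j ∈ (q.dropUntil i hi).support := by
    rw [← hspec, SimpleGraph.Walk.mem_support_append_iff] at hj
    exact hj
  rcases hj' with h | h
  · set q1 := q.takeUntil i hi
    have hq1 : q1.IsPath := hq.takeUntil hi
    have hr := path_eq hT p.reverse (q1.dropUntil j h) hp.reverse (hq1.dropUntil h)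
    have hl : p.length = (q1.dropUntil j h).length := by
      rw [← hr, SimpleGraph.Walk.length_reverse]
    have hlen2 : (q1.takeUntil j h).length + (q1.dropUntil j h).length = q1.length := by
      rw [← SimpleGraph.Walk.length_append, q1.take_spec h]
    refine ⟨by omega, fun heq => Or.inr ⟨?_, ?_⟩⟩
    · exact SimpleGraph.Walk.eq_of_length_eq_zero (p := q.dropUntil i hi) (by omega)
    · exact (SimpleGraph.Walk.eq_of_length_eq_zero (p := q1.takeUntil j h) (by omega)).symm
  · set q2 := q.dropUntil i hi
    have hq2 : q2.IsPath := hq.dropUntil hi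
    have hr := path_eq hT p (q2.takeUntil j h) hp (hq2.takeUntil h)
    have hl : p.length = (q2.takeUntil j h).length := by
      rw [← hr]
    have hlen2 : (q2.takeUntil j h).length + (q2.dropUntil j h).length = q2.length := by
      rw [← SimpleGraph.Walk.length_append, q2.take_spec h]
    refine ⟨by omega, fun heq => Or.inl ⟨?_, ?_⟩⟩
    · exact (SimpleGraph.Walk.eq_of_length_eq_zero (p := q.takeUntil i hi) (by omega)).symm
    · exact SimpleGraph.Walk.eq_of_length_eq_zero (p := q2.dropUntil j h) (by omega)

lemma path_ends (hT : T.IsAcyclic) {i j k l : Fin n} (p : T.Walk i j) (q : T.Walk k l)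
    (hp : p.IsPath) (hq : q.IsPath) (hi : i ∈ q.support) (hj : j ∈ q.support)
    (hk : k ∈ p.support) (hl : l ∈ p.support) :
    (i = k ∧ j = l) ∨ (i = l ∧ j = k) := by
  have h1 := path_sub hT p q hp hq hi hj
  have h2 := path_sub hT q p hq hp hk hl
  exact h1.2 (by omega)

end Graph

section Mat
variable {K : Type*} [Field K] {n : ℕ} {G T : SimpleGraph (Fin n)}

lemma sparse_diag (i : Fin n) : sparseGenericSym K n G i i = X s(i, i) := by
  simp [sparseGenericSym]

lemma sparse_adj {i j : Fin n} (h : G.Adj i j) : sparseGenericSym K n G i j = X s(i, j) := by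
  simp [sparseGenericSym, h]

lemma sparse_not {i j : Fin n} (h : i ≠ j) (h' : ¬ G.Adj i j) :
    sparseGenericSym K n G i j = 0 := by
  simp [sparseGenericSym, h, h']

lemma sparse_symm : (sparseGenericSym K n G).transpose = sparseGenericSym K n G := by
  ext1 i j
  rw [Matrix.transpose_apply]
  unfold sparseGenericSym
  simp only [Sym2.eq_swap (a := j), G.adj_comm j i, eq_comm (a := j) (b := i)]

variable (K G) in
/-- Entries of the adjugate. -/
noncomputable def adj (i j : Fin n) : SymPolyRing K n :=
  (sparseGenericSym K n G).adjugate i j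

lemma adj_symm (i j : Fin n) : adj K G i j = adj K G j i := by
  unfold adj
  conv_rhs => rw [← sparse_symm, ← Matrix.adjugate_transpose, Matrix.transpose_apply]

lemma adj_rel (i j : Fin n) : ∑ k, sparseGenericSym K n G i k * adj K G k j =
    if i = j then (sparseGenericSym K n G).det else 0 := by
  have := congrFun (congrFun (Matrix.mul_adjugate (sparseGenericSym K n G)) i) j
  rw [Matrix.mul_apply] at this
  unfold adj
  rw [this]
  simp [Matrix.one_apply]

lemma adj_rel' {i j : Fin n} (h : i ≠ j) :
    X s(i, i) * adj K G i j = - ∑ k ∈ Finset.univ.erase i,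
      sparseGenericSym K n G i k * adj K G k j := by
  have := adj_rel (K := K) (G := G) i j
  rw [if_neg h, ← Finset.add_sum_erase _ _ (Finset.mem_univ i), sparse_diag] at this
  exact eq_neg_of_add_eq_zero_left this

lemma sum_ite_ne (j : Fin n) (c : ℕ) : (∑ r, if r = j then 0 else c) = (n - 1) * c := by
  rw [Finset.sum_ite]
  simp [Finset.filter_ne', Finset.card_erase_of_mem]

lemma adj_homog (w : Sym2 (Fin n) → ℕ) (c : ℕ)
    (hw : ∀ i j, IsWeightedHomogeneous w (sparseGenericSym K n G i j) c) (i j : Fin n) :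
    IsWeightedHomogeneous w (adj K G i j) ((n - 1) * c) := by
  unfold adj
  rw [Matrix.adjugate_apply, Matrix.det_apply]
  apply IsWeightedHomogeneous.sum
  intro σ _
  have h1 : ∀ r v, IsWeightedHomogeneous w
      ((sparseGenericSym K n G).updateRow j (Pi.single i 1) r v) (if r = j then 0 else c) := by
    intro r v
    rw [Matrix.updateRow_apply]
    split_ifs with h
    · rw [Pi.single_apply]
      split_ifs
      · exact isWeightedHomogeneous_one _ _
      · exact isWeightedHomogeneous_zero _ _ _
    · exact hw r v
  have h2 : IsWeightedHomogeneous w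
      (∏ v, (sparseGenericSym K n G).updateRow j (Pi.single i 1) (σ v) v)
      (∑ v, if σ v = j then 0 else c) :=
    IsWeightedHomogeneous.prod _ _ _ fun v _ => h1 (σ v) v
  have h3 : (∑ v, if σ v = j then 0 else c) = (n - 1) * c := by
    rw [Equiv.sum_comp σ (fun r => if r = j then 0 else c), sum_ite_ne]
  rw [h3] at h2
  rcases Int.units_eq_one_or (Equiv.Perm.sign σ) with h | h
  · rw [h, one_smul]; exact h2
  · rw [h, Units.neg_smul, one_smul]; exact h2.neg

lemma adj_deg {i j : Fin n} {m : Sym2 (Fin n) →₀ ℕ} (h : coeff m (adj K G i j) ≠ 0) :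
    monWeight (fun _ => 1) m = n - 1 := by
  have := adj_homog (K := K) (G := G) (fun _ => 1) 1 (by
    intro i j
    unfold sparseGenericSym
    split_ifs
    · exact isWeightedHomogeneous_X _ _ _
    · exact isWeightedHomogeneous_zero _ _ _) i j
  rw [monWeight_eq, this h, mul_one]

lemma adj_gw {i j : Fin n} {m : Sym2 (Fin n) →₀ ℕ} (h : coeff m (adj K G i j) ≠ 0) :
    monWeight (graphWeight G) m = (n - 1) * 2 := by
  have := adj_homog (K := K) (G := G) (graphWeight G) 2 (by
    intro i j
    unfold sparseGenericSym
    split_ifs with h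
    · have h2 : graphWeight G s(i, j) = 2 := by simp [graphWeight, h]
      rw [← h2]
      exact isWeightedHomogeneous_X _ _ _
    · exact isWeightedHomogeneous_zero _ _ _) i j
  rw [monWeight_eq, this h]

lemma coeff_adj_self (j : Fin n) (m : Sym2 (Fin n) →₀ ℕ)
    (hm : monWeight (cw T) (pexp (SimpleGraph.Walk.nil : T.Walk j j)) ≤ monWeight (cw T) m) :
    coeff m (adj K G j j) =
      if m = pexp (SimpleGraph.Walk.nil : T.Walk j j) then 1 else 0 := by
  unfold adj
  rw [Matrix.adjugate_apply, Matrix.det_apply,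
    ← Finset.add_sum_erase _ _ (Finset.mem_univ (1 : Equiv.Perm (Fin n))), coeff_add]
  have hone : (Equiv.Perm.sign (1 : Equiv.Perm (Fin n))) •
      ∏ v, (sparseGenericSym K n G).updateRow j (Pi.single j 1) ((1 : Equiv.Perm (Fin n)) v) v
      = monomial (pexp (SimpleGraph.Walk.nil : T.Walk j j)) 1 := by
    rw [Equiv.Perm.sign_one, one_smul, pexp_nil, monomial_sum_one,
      ← Finset.mul_prod_erase _ _ (Finset.mem_univ j)]
    simp only [Equiv.Perm.coe_one, id_eq, Matrix.updateRow_self, Pi.single_eq_same, one_mul]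
    apply Finset.prod_congr rfl
    intro v hv
    rw [Matrix.updateRow_ne (Finset.ne_of_mem_erase hv), sparse_diag]
    rfl
  have hrest : coeff m (∑ σ ∈ (Finset.univ : Finset (Equiv.Perm (Fin n))).erase 1,
      Equiv.Perm.sign σ • ∏ v, (sparseGenericSym K n G).updateRow j (Pi.single j 1) (σ v) v)
      = 0 := by
    rw [coeff_sum]
    apply Finset.sum_eq_zero
    intro σ hσ
    have hσ1 := Finset.ne_of_mem_erase hσ
    set d : Fin n → Fin n → ℕ := fun r v => if r = j then 0 else cw T s(r, v) with hd
    have h1 : ∀ r v, IsWeightedHomogeneous (cw T)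
        ((sparseGenericSym K n G).updateRow j (Pi.single j 1) r v) (d r v) := by
      intro r v
      rw [Matrix.updateRow_apply, hd]
      dsimp only
      split_ifs with h
      · rw [Pi.single_apply]
        split_ifs
        · exact isWeightedHomogeneous_one _ _
        · exact isWeightedHomogeneous_zero _ _ _
      · unfold sparseGenericSym
        split_ifs
        · exact isWeightedHomogeneous_X _ _ _
        · exact isWeightedHomogeneous_zero _ _ _
    have h2 : IsWeightedHomogeneous (cw T)
        (∏ v, (sparseGenericSym K n G).updateRow j (Pi.single j 1) (σ v) v)
        (∑ v, d (σ v) v) :=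
      IsWeightedHomogeneous.prod _ _ _ fun v _ => h1 (σ v) v
    have h3 : ∑ v, d (σ v) v < ∑ v, (if σ v = j then 0 else n + 1) := by
      apply Finset.sum_lt_sum
      · intro v _
        rw [hd]
        dsimp only
        split_ifs
        · rfl
        · unfold cw; split_ifs <;> omega
      · have : ∃ v, σ v ≠ v ∧ σ v ≠ j := by
          by_contra hcon
          push Not at hcon
          apply hσ1
          ext1 v
          rw [Equiv.Perm.one_apply]
          by_contra hv
          have e1 := hcon v hv
          have e2 : σ (σ v) ≠ σ v := fun h => hv (σ.injective h)
          have e3 := hcon _ e2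
          exact e2 (e3.trans e1.symm)
        obtain ⟨v, hv, hvj⟩ := this
        refine ⟨v, Finset.mem_univ _, ?_⟩
        rw [hd]
        simp only [hvj, if_false]
        unfold cw
        rw [if_neg (by simpa using hv)]
        split_ifs <;> omega
    rw [Equiv.sum_comp σ (fun r => if r = j then 0 else n + 1), sum_ite_ne] at h3
    have h4 := cw_pexp (SimpleGraph.Walk.nil : T.Walk j j) (by simp)
    rw [SimpleGraph.Walk.length_nil] at h4
    have h5 : coeff m (∏ v, (sparseGenericSym K n G).updateRow j (Pi.single j 1) (σ v) v)
        = 0 := by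
      by_contra h
      have := h2 h
      rw [← monWeight_eq] at this
      have hn : 0 < n := j.pos
      obtain ⟨k, rfl⟩ : ∃ k, n = k + 1 := ⟨n - 1, by omega⟩
      simp only [Nat.add_sub_cancel] at h3
      nlinarith
    rcases Int.units_eq_one_or (Equiv.Perm.sign σ) with h | h
    · rw [h, one_smul]; exact h5
    · rw [h, Units.neg_smul, one_smul, coeff_neg, h5, neg_zero]
  rw [hone, hrest, add_zero, coeff_monomial]
  simp only [eq_comm]

lemma coeff_sparse_mul {i k : Fin n} (hik : i ≠ k) (M : Sym2 (Fin n) →₀ ℕ)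
    (f : SymPolyRing K n) :
    coeff M (sparseGenericSym K n G i k * f) = 0 ∨ (G.Adj i k ∧
      ∃ m', M = m' + Finsupp.single s(i, k) 1 ∧
        coeff M (sparseGenericSym K n G i k * f) = coeff m' f) := by
  by_cases h : G.Adj i k
  · rw [sparse_adj h, coeff_X_mul']
    split_ifs with hs
    · right
      refine ⟨h, M - Finsupp.single s(i, k) 1, ?_, rfl⟩
      rw [tsub_add_cancel_of_le]
      rw [Finsupp.single_le_iff]
      have := Finsupp.mem_support_iff.1 hs
      omega
    · left; rfl
  · left
    rw [sparse_not hik h, zero_mul, coeff_zero]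

lemma cw_lt {i k : Fin n} (hik : i ≠ k) : cw T s(i, k) ≤ n := by
  unfold cw
  rw [if_neg (by simpa using hik)]
  split_ifs <;> omega

lemma coeff_rel {i j : Fin n} (h : i ≠ j) (m : Sym2 (Fin n) →₀ ℕ) :
    coeff m (adj K G i j) = - ∑ k ∈ Finset.univ.erase i,
      coeff (m + Finsupp.single s(i, i) 1) (sparseGenericSym K n G i k * adj K G k j) := by
  have := congrArg (coeff (m + Finsupp.single s(i, i) 1)) (adj_rel' (K := K) (G := G) h)
  rw [add_comm m, coeff_X_mul, coeff_neg, coeff_sum] at this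
  rw [this, add_comm m]

lemma exists_bound (j : Fin n) : ∃ B, ∀ m i, B < monWeight (cw T) m →
    coeff m (adj K G i j) = 0 := by
  refine ⟨∑ i, topWeight (cw T) (adj K G i j), fun m i h => ?_⟩
  by_contra hc
  have h1 := le_topWeight (cw T) _ m hc
  have h2 := Finset.single_le_sum (f := fun i => topWeight (cw T) (adj K G i j))
    (fun _ _ => Nat.zero_le _) (Finset.mem_univ i)
  omega

lemma adj_eq_zero {i j : Fin n} (h : ¬ G.Reachable i j) : adj K G i j = 0 := by
  obtain ⟨B, hB⟩ := exists_bound (K := K) (G := G) (T := (⊥ : SimpleGraph (Fin n))) j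
  have key : ∀ d m, B < monWeight (cw (⊥ : SimpleGraph (Fin n))) m + d → ∀ i,
      ¬ G.Reachable i j → coeff m (adj K G i j) = 0 := by
    intro d
    induction d with
    | zero => intro m hm i _; exact hB m i hm
    | succ d ih =>
      intro m hm i hi
      have hij : i ≠ j := by rintro rfl; exact hi (SimpleGraph.Reachable.refl _)
      rw [coeff_rel hij, neg_eq_zero]
      apply Finset.sum_eq_zero
      intro k hk
      have hik : i ≠ k := (Finset.ne_of_mem_erase hk).symm
      rcases coeff_sparse_mul (G := G) hik (m + Finsupp.single s(i, i) 1) (adj K G k j) with h0 | ⟨hadj, m', hm', h0⟩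
      · exact h0
      · rw [h0]
        apply ih
        · have := congrArg (monWeight (cw (⊥ : SimpleGraph (Fin n)))) hm'
          rw [monWeight_add, monWeight_add, monWeight_single, monWeight_single, cw_diag] at this
          have := cw_lt (T := (⊥ : SimpleGraph (Fin n))) hik
          omega
        · intro hr
          exact hi (hadj.reachable.trans hr)
  ext m
  rw [coeff_zero]
  exact key (B + 1) m (by omega) i h

lemma exists_path (hspan : ∀ u v : Fin n, T.Reachable u v ↔ G.Reachable u v)
    {i j : Fin n} (h : G.Reachable i j) : ∃ p : T.Walk i j, p.IsPath := by
  obtain ⟨p, hp⟩ := ((hspan i j).2 h).exists_isPath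
  exact ⟨p, hp⟩

/-- Path from a `G`-neighbour of the start of a path, not the second vertex, with the weight
estimate. -/
lemma other_nbr (hT : T.IsAcyclic)
    (hspan : ∀ u v : Fin n, T.Reachable u v ↔ G.Reachable u v) {i i' j k : Fin n}
    (h : T.Adj i i') (p : T.Walk i' j) (hp : (SimpleGraph.Walk.cons h p).IsPath)
    (hk : G.Adj i k) (hne : k ≠ i') :
    ∃ q : T.Walk k j, q.IsPath ∧ monWeight (cw T) (pexp q) + cw T s(i, k) <
      monWeight (cw T) (pexp (SimpleGraph.Walk.cons h p)) + (n + 1) := by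
  have hW := cw_pexp _ hp
  by_cases hTk : T.Adj i k
  · have hoff := nbr_off_path hT h p hp hTk hne
    have hq : (SimpleGraph.Walk.cons hTk.symm (SimpleGraph.Walk.cons h p)).IsPath :=
      (SimpleGraph.Walk.cons_isPath_iff _ _).2 ⟨hp, hoff⟩
    refine ⟨_, hq, ?_⟩
    have hW2 := cw_pexp _ hq
    rw [cw_adj hTk]
    rw [SimpleGraph.Walk.length_cons] at hW2
    omega
  · have hr : G.Reachable k j :=
      hk.symm.reachable.trans ((hspan i j).1 ⟨SimpleGraph.Walk.cons h p⟩)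
    obtain ⟨q, hq⟩ := exists_path hspan hr
    refine ⟨q, hq, ?_⟩
    have hW2 := cw_pexp _ hq
    have hl := hp.length_lt
    rw [Fintype.card_fin] at hl
    rw [cw_not hk.ne hTk]
    omega

/-- The leading coefficient of the adjugate entries. -/
lemma coeff_adj (hTG : T ≤ G) (hT : T.IsAcyclic)
    (hspan : ∀ u v : Fin n, T.Reachable u v ↔ G.Reachable u v)
    {i j : Fin n} (p : T.Walk i j) (hp : p.IsPath) (m : Sym2 (Fin n) →₀ ℕ)
    (hm : monWeight (cw T) (pexp p) ≤ monWeight (cw T) m) :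
    coeff m (adj K G i j) = if m = pexp p then (-1) ^ p.length else 0 := by
  obtain ⟨B, hB⟩ := exists_bound (K := K) (G := G) (T := T) j
  have key : ∀ d m, B + n * (n + 1) < monWeight (cw T) m + d → ∀ i (p : T.Walk i j), p.IsPath →
      monWeight (cw T) (pexp p) ≤ monWeight (cw T) m →
      coeff m (adj K G i j) = if m = pexp p then (-1) ^ p.length else 0 := by
    intro d
    induction d with
    | zero =>
      intro m hm i p hp _
      rw [hB m i (by omega), if_neg]
      rintro rfl
      have := cw_pexp p hp
      omega
    | succ d ih =>
      intro m hd i p hp hm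
      cases p with
      | nil =>
        rw [coeff_adj_self (T := T) j m hm, SimpleGraph.Walk.length_nil, pow_zero]
      | cons h p =>
        rename_i i'
        have hp' := (SimpleGraph.Walk.cons_isPath_iff h p).1 hp
        have hij : i ≠ j := by
          rintro rfl; exact hp'.2 p.end_mem_support
        have hcons := pexp_cons h p hp'.2
        have hWc := congrArg (monWeight (cw T)) hcons
        rw [monWeight_add, monWeight_add, monWeight_single, monWeight_single, cw_diag,
          cw_adj h] at hWc
        rw [coeff_rel hij, ← Finset.add_sum_erase _ _
          (Finset.mem_erase.2 ⟨h.ne', Finset.mem_univ i'⟩)]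
        rw [Finset.sum_eq_zero, add_zero]
        · rw [sparse_adj (hTG h)]
          by_cases hmp : m = pexp (SimpleGraph.Walk.cons h p)
          · rw [if_pos hmp, hmp, hcons, add_comm (pexp p), coeff_X_mul,
              ih _ _ _ p hp'.1 le_rfl, if_pos rfl, SimpleGraph.Walk.length_cons, pow_succ]
            · ring
            · rw [← hmp] at hWc
              omega
          · rw [if_neg hmp, coeff_X_mul', neg_eq_zero]
            split_ifs with hs
            · set m' := m + Finsupp.single s(i, i) 1 - Finsupp.single s(i, i') 1 with hm'
              have e : m' + Finsupp.single s(i, i') 1 = m + Finsupp.single s(i, i) 1 := by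
                rw [hm', tsub_add_cancel_of_le]
                rw [Finsupp.single_le_iff]
                have := Finsupp.mem_support_iff.1 hs
                omega
              have eW := congrArg (monWeight (cw T)) e
              rw [monWeight_add, monWeight_add, monWeight_single, monWeight_single, cw_diag,
                cw_adj h] at eW
              rw [ih m' (by omega) _ p hp'.1 (by omega), if_neg]
              intro hh
              apply hmp
              rw [hh, ← hcons] at e
              exact (add_right_cancel e).symm
            · rfl
        · intro k hk
          have hki' : k ≠ i' := Finset.ne_of_mem_erase hk
          have hik : i ≠ k := (Finset.ne_of_mem_erase (Finset.mem_of_mem_erase hk)).symm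
          rcases coeff_sparse_mul (G := G) hik (m + Finsupp.single s(i, i) 1) (adj K G k j) with h0 | ⟨hadj, m', hm', h0⟩
          · exact h0
          · rw [h0]
            obtain ⟨q, hq, hqW⟩ := other_nbr hT hspan h p hp hadj hki'
            have eW := congrArg (monWeight (cw T)) hm'
            rw [monWeight_add, monWeight_add, monWeight_single, monWeight_single, cw_diag] at eW
            have := cw_lt (T := T) hik
            rw [ih m' (by omega) _ q hq (by omega), if_neg]
            rintro rfl
            omega
  exact key (B + n * (n + 1) + 1) m (by omega) i p hp hm

end Mat

section Link
variable {K : Type*} [Field K] {n : ℕ} {G T : SimpleGraph (Fin n)}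

/-- Membership in `V` of the multiple of the adjugate entry with leading monomial `L`. -/
def Good (G : SimpleGraph (Fin n)) (V : Submodule K (SymPolyRing K n))
    (L : Sym2 (Fin n) →₀ ℕ) {i j : Fin n} (p : T.Walk i j) : Prop :=
  ∀ ν, ν + pexp p = L → monomial ν (1 : K) * adj K G i j ∈ V

/-- All multiples of adjugate entries with leading monomial of smaller weight lie in `V`. -/
def Low (G T : SimpleGraph (Fin n)) (V : Submodule K (SymPolyRing K n))
    (L : Sym2 (Fin n) →₀ ℕ) : Prop :=
  ∀ ν (k j : Fin n) (q : T.Walk k j), q.IsPath →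
    monWeight (cw T) (ν + pexp q) < monWeight (cw T) L → monomial ν (1 : K) * adj K G k j ∈ V

variable {V : Submodule K (SymPolyRing K n)} {L : Sym2 (Fin n) →₀ ℕ}

lemma good_reverse {i j : Fin n} (p : T.Walk i j) : Good G V L p.reverse ↔ Good G V L p := by
  unfold Good
  rw [pexp_reverse, adj_symm]

lemma mon_add (ν : Sym2 (Fin n) →₀ ℕ) (e : Sym2 (Fin n)) (f : SymPolyRing K n) :
    monomial (ν + Finsupp.single e 1) (1 : K) * f = monomial ν 1 * (X e * f) := by
  rw [← mul_assoc, X, monomial_mul, one_mul]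

lemma exists_nu {i j : Fin n} {p : T.Walk i j} (hL : pexp p ≤ L) {v : Fin n}
    (hv : v ∈ p.support) (hLv : L s(v, v) ≠ 0) :
    ∃ ν, ν + Finsupp.single s(v, v) 1 + pexp p = L := by
  refine ⟨L - pexp p - Finsupp.single s(v, v) 1, ?_⟩
  rw [tsub_add_cancel_of_le, tsub_add_cancel_of_le hL]
  rw [Finsupp.single_le_iff, Finsupp.tsub_apply, pexp_diag, if_pos hv]
  omega

lemma good_iff_of_nu {i j : Fin n} {p : T.Walk i j} {ν : Sym2 (Fin n) →₀ ℕ}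
    (h : ν + pexp p = L) : Good G V L p ↔ monomial ν (1 : K) * adj K G i j ∈ V := by
  constructor
  · intro hg; exact hg ν h
  · intro hm ν' h'
    rw [← h] at h'
    rwa [add_right_cancel h']

lemma good_cons (hTG : T ≤ G) (hT : T.IsAcyclic)
    (hspan : ∀ u v : Fin n, T.Reachable u v ↔ G.Reachable u v) (hlow : Low G T V L)
    {i i' j : Fin n} (h : T.Adj i i') (p : T.Walk i' j)
    (hp : (SimpleGraph.Walk.cons h p).IsPath) (hL : pexp (SimpleGraph.Walk.cons h p) ≤ L)
    (hi : L s(i, i) ≠ 0) :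
    pexp p ≤ L ∧ (Good G V L (SimpleGraph.Walk.cons h p) ↔ Good G V L p) := by
  have hp' := (SimpleGraph.Walk.cons_isPath_iff h p).1 hp
  have hij : i ≠ j := by
    rintro rfl; exact hp'.2 p.end_mem_support
  have hcons := pexp_cons h p hp'.2
  obtain ⟨ν, hν⟩ := exists_nu hL (SimpleGraph.Walk.start_mem_support _) hi
  have hν' : ν + Finsupp.single s(i, i') 1 + pexp p = L := by
    rw [← hν, add_assoc, add_comm _ (pexp p), ← hcons, add_assoc, add_comm (pexp _)]
  refine ⟨?_, ?_⟩
  · rw [← hν']; exact le_add_self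
  · rw [good_iff_of_nu hν, good_iff_of_nu hν', mon_add, mon_add, adj_rel' hij,
      ← Finset.add_sum_erase _ _ (Finset.mem_erase.2 ⟨h.ne', Finset.mem_univ i'⟩),
      sparse_adj (hTG h), mul_neg, neg_mem_iff, mul_add]
    apply Submodule.add_mem_iff_left
    rw [Finset.mul_sum]
    apply Submodule.sum_mem
    intro k hk
    have hki' : k ≠ i' := Finset.ne_of_mem_erase hk
    have hik : i ≠ k := (Finset.ne_of_mem_erase (Finset.mem_of_mem_erase hk)).symm
    by_cases hadj : G.Adj i k
    · rw [sparse_adj hadj, ← mon_add]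
      obtain ⟨q, hq, hqW⟩ := other_nbr hT hspan h p hp hadj hki'
      apply hlow _ _ _ q hq
      rw [← hν]
      simp only [monWeight_add, monWeight_single, cw_diag]
      omega
    · rw [sparse_not hik hadj, zero_mul, mul_zero]
      exact V.zero_mem

lemma nil_rest (hT : T.IsAcyclic)
    (hspan : ∀ u v : Fin n, T.Reachable u v ↔ G.Reachable u v) (hlow : Low G T V L)
    (i : Fin n) (ν : Sym2 (Fin n) →₀ ℕ)
    (hν : ν + Finsupp.single s(i, i) 1 + pexp (SimpleGraph.Walk.nil : T.Walk i i) = L) :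
    monomial ν (1 : K) * ∑ k ∈ Finset.univ.erase i,
      sparseGenericSym K n G i k * adj K G k i ∈ V := by
  have h0 := cw_pexp (SimpleGraph.Walk.nil : T.Walk i i) (by simp)
  rw [SimpleGraph.Walk.length_nil] at h0
  rw [Finset.mul_sum]
  apply Submodule.sum_mem
  intro k hk
  have hik : i ≠ k := (Finset.ne_of_mem_erase hk).symm
  by_cases hadj : G.Adj i k
  · rw [sparse_adj hadj, ← mon_add]
    obtain ⟨q, hq⟩ := exists_path hspan hadj.symm.reachable
    apply hlow _ _ _ q hq
    have h1 := cw_pexp q hq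
    have h2 := cw_lt (T := T) hik
    rw [← hν]
    simp only [monWeight_add, monWeight_single, cw_diag]
    omega
  · rw [sparse_not hik hadj, zero_mul, mul_zero]
    exact V.zero_mem

lemma good_nil (hT : T.IsAcyclic)
    (hspan : ∀ u v : Fin n, T.Reachable u v ↔ G.Reachable u v) (hlow : Low G T V L)
    (hL : ∀ v, L s(v, v) ≠ 0) (i j : Fin n)
    (hi : pexp (SimpleGraph.Walk.nil : T.Walk i i) ≤ L)
    (hj : pexp (SimpleGraph.Walk.nil : T.Walk j j) ≤ L) :
    Good G V L (SimpleGraph.Walk.nil : T.Walk i i) ↔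
      Good G V L (SimpleGraph.Walk.nil : T.Walk j j) := by
  obtain ⟨ν, hν⟩ := exists_nu hi (v := i) (by simp) (hL i)
  obtain ⟨ν', hν'⟩ := exists_nu hj (v := j) (by simp) (hL j)
  have hnn : ν = ν' := by
    have e : ∀ i : Fin n, Finsupp.single s(i, i) 1 +
        pexp (SimpleGraph.Walk.nil : T.Walk i i) = ∑ v, Finsupp.single s(v, v) 1 := by
      intro i
      rw [pexp_nil]
      exact Finset.add_sum_erase Finset.univ
        (fun v => (Finsupp.single s(v, v) 1 : Sym2 (Fin n) →₀ ℕ)) (Finset.mem_univ i)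
    rw [add_assoc, e] at hν hν'
    exact add_right_cancel (hν.trans hν'.symm)
  subst hnn
  have r1 := nil_rest (K := K) hT hspan hlow i ν hν
  have r2 := nil_rest (K := K) hT hspan hlow j ν hν'
  have s : ∀ i : Fin n, X s(i, i) * adj K G i i + ∑ k ∈ Finset.univ.erase i,
      sparseGenericSym K n G i k * adj K G k i = (sparseGenericSym K n G).det := by
    intro i
    have := adj_rel (K := K) (G := G) i i
    rwa [if_pos rfl, ← Finset.add_sum_erase _ _ (Finset.mem_univ i), sparse_diag] at this
  rw [good_iff_of_nu hν, good_iff_of_nu hν', mon_add, mon_add]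
  have e1 : (monomial ν (1 : K) * (X s(i, i) * adj K G i i) ∈ V) ↔
      monomial ν (1 : K) * (sparseGenericSym K n G).det ∈ V := by
    rw [← s i, mul_add]
    exact (Submodule.add_mem_iff_left V r1).symm
  have e2 : (monomial ν (1 : K) * (X s(j, j) * adj K G j j) ∈ V) ↔
      monomial ν (1 : K) * (sparseGenericSym K n G).det ∈ V := by
    rw [← s j, mul_add]
    exact (Submodule.add_mem_iff_left V r2).symm
  exact e1.trans e2.symm

/-- Reduction to a single vertex, if all diagonal variables divide `L`. -/
lemma good_end (hTG : T ≤ G) (hT : T.IsAcyclic)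
    (hspan : ∀ u v : Fin n, T.Reachable u v ↔ G.Reachable u v) (hlow : Low G T V L)
    (hLd : ∀ v, L s(v, v) ≠ 0) {i j : Fin n} (p : T.Walk i j) (hp : p.IsPath)
    (hL : pexp p ≤ L) :
    pexp (SimpleGraph.Walk.nil : T.Walk j j) ≤ L ∧
    (Good G V L p ↔ Good G V L (SimpleGraph.Walk.nil : T.Walk j j)) := by
  induction p with
  | nil => exact ⟨hL, Iff.rfl⟩
  | cons h p ih =>
    have h1 := good_cons hTG hT hspan hlow h p hp hL (hLd _)
    have h2 := ih ((SimpleGraph.Walk.cons_isPath_iff h p).1 hp).1 h1.1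
    exact ⟨h2.1, h1.2.trans h2.2⟩

lemma support_of_le {i j : Fin n} {p : T.Walk i j} (hL : pexp p ≤ L) {v : Fin n}
    (hv : L s(v, v) = 0) : v ∈ p.support := by
  by_contra h
  have := hL s(v, v)
  rw [pexp_diag, if_neg h, hv] at this
  omega

/-- Reduction to a path with both ends in the set of vertices missing from `L`. -/
lemma good_reduce (hTG : T ≤ G) (hT : T.IsAcyclic)
    (hspan : ∀ u v : Fin n, T.Reachable u v ↔ G.Reachable u v) (hlow : Low G T V L)
    (u : Fin n) (hu : L s(u, u) = 0) : ∀ (N : ℕ) {i j : Fin n} (p : T.Walk i j), p.IsPath →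
    pexp p ≤ L → p.length ≤ N →
    ∃ (i' j' : Fin n) (q : T.Walk i' j'), q.IsPath ∧ pexp q ≤ L ∧ L s(i', i') = 0 ∧
      L s(j', j') = 0 ∧ (Good G V L p ↔ Good G V L q) := by
  intro N
  induction N with
  | zero =>
    intro i j p hp hL hl
    have hup := support_of_le hL hu
    cases p with
    | nil =>
      rw [SimpleGraph.Walk.support_nil, List.mem_singleton] at hup
      subst hup
      exact ⟨_, _, _, hp, hL, hu, hu, Iff.rfl⟩
    | cons h p => simp at hl
  | succ N ih =>
    have step : ∀ {i j : Fin n} (p : T.Walk i j), p.IsPath → pexp p ≤ L → p.length ≤ N + 1 →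
        L s(i, i) ≠ 0 →
        ∃ (i' j' : Fin n) (q : T.Walk i' j'), q.IsPath ∧ pexp q ≤ L ∧ L s(i', i') = 0 ∧
          L s(j', j') = 0 ∧ (Good G V L p ↔ Good G V L q) := by
      intro i j p hp hL hl hi
      have hup := support_of_le hL hu
      cases p with
      | nil =>
        rw [SimpleGraph.Walk.support_nil, List.mem_singleton] at hup
        subst hup
        exact absurd hu hi
      | cons h p =>
        have h1 := good_cons hTG hT hspan hlow h p hp hL hi
        rw [SimpleGraph.Walk.length_cons] at hl
        obtain ⟨i', j', q, hq, hqL, hi', hj', hg⟩ :=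
          ih p ((SimpleGraph.Walk.cons_isPath_iff h p).1 hp).1 h1.1 (by omega)
        exact ⟨i', j', q, hq, hqL, hi', hj', h1.2.trans hg⟩
    intro i j p hp hL hl
    by_cases hi : L s(i, i) = 0
    · by_cases hj : L s(j, j) = 0
      · exact ⟨i, j, p, hp, hL, hi, hj, Iff.rfl⟩
      · obtain ⟨i', j', q, hq, hqL, hi', hj', hg⟩ := step p.reverse hp.reverse
          (by rw [pexp_reverse]; exact hL) (by rw [SimpleGraph.Walk.length_reverse]; exact hl) hj
        exact ⟨i', j', q, hq, hqL, hi', hj', (good_reverse p).symm.trans hg⟩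
    · exact step p hp hL hl hi

lemma good_link (hTG : T ≤ G) (hT : T.IsAcyclic)
    (hspan : ∀ u v : Fin n, T.Reachable u v ↔ G.Reachable u v) (hlow : Low G T V L)
    {i j k l : Fin n} (p : T.Walk i j) (q : T.Walk k l) (hp : p.IsPath) (hq : q.IsPath)
    (hpL : pexp p ≤ L) (hqL : pexp q ≤ L) : Good G V L p ↔ Good G V L q := by
  by_cases hLd : ∀ v, L s(v, v) ≠ 0
  · obtain ⟨a1, a2⟩ := good_end hTG hT hspan hlow hLd p hp hpL
    obtain ⟨b1, b2⟩ := good_end hTG hT hspan hlow hLd q hq hqL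
    rw [a2, b2]
    exact good_nil hT hspan hlow hLd _ _ a1 b1
  · push Not at hLd
    obtain ⟨u, hu⟩ := hLd
    obtain ⟨i1, j1, p1, hp1, hpL1, hi1, hj1, hg1⟩ :=
      good_reduce hTG hT hspan hlow u hu _ p hp hpL le_rfl
    obtain ⟨i2, j2, p2, hp2, hpL2, hi2, hj2, hg2⟩ :=
      good_reduce hTG hT hspan hlow u hu _ q hq hqL le_rfl
    rw [hg1, hg2]
    rcases path_ends hT p1 p2 hp1 hp2 (support_of_le hpL2 hi1) (support_of_le hpL2 hj1)
      (support_of_le hpL1 hi2) (support_of_le hpL1 hj2) with ⟨rfl, rfl⟩ | ⟨rfl, rfl⟩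
    · rw [path_eq hT p1 p2 hp1 hp2]
    · rw [path_eq hT p1 p2.reverse hp1 hp2.reverse, good_reverse]

/-- Monomials in the forest ideal. -/
abbrev LT (T : SimpleGraph (Fin n)) :=
  {L : Sym2 (Fin n) →₀ ℕ // ∃ (i j : Fin n) (p : T.Walk i j), p.IsPath ∧ pexp p ≤ L}

lemma all_mem_span (hTG : T ≤ G) (hT : T.IsAcyclic)
    (hspan : ∀ u v : Fin n, T.Reachable u v ↔ G.Reachable u v)
    (V : Submodule K (SymPolyRing K n))
    (hV : ∀ L : LT T, ∃ (i j : Fin n) (p : T.Walk i j), p.IsPath ∧ pexp p ≤ L.1 ∧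
      monomial (L.1 - pexp p) (1 : K) * adj K G i j ∈ V) :
    ∀ ν (k j : Fin n) (q : T.Walk k j), q.IsPath → monomial ν (1 : K) * adj K G k j ∈ V := by
  have key : ∀ d ν (k j : Fin n) (q : T.Walk k j), q.IsPath →
      monWeight (cw T) (ν + pexp q) < d → monomial ν (1 : K) * adj K G k j ∈ V := by
    intro d
    induction d with
    | zero => intro ν k j q _ h; omega
    | succ d ih =>
      intro ν k j q hq hd
      have hlow : Low G T V (ν + pexp q) := by
        intro ν' k' j' q' hq' hlt
        exact ih ν' k' j' q' hq' (by omega)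
      have hqL : pexp q ≤ ν + pexp q := le_add_self
      obtain ⟨i, j, p, hp, hpL, hm⟩ := hV ⟨ν + pexp q, _, _, q, hq, hqL⟩
      have := (good_link hTG hT hspan hlow p q hp hq hpL hqL).1
        ((good_iff_of_nu (tsub_add_cancel_of_le hpL)).2 hm)
      exact this ν rfl
  intro ν k j q hq
  exact key _ ν k j q hq (Nat.lt_succ_self _)

end Link

section Final
variable {K : Type*} [Field K] {n : ℕ} {G T : SimpleGraph (Fin n)}

lemma exists_perm_succAbove {m : ℕ} (f : Fin m → Fin (m + 1)) (hf : Function.Injective f) :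
    ∃ (i : Fin (m + 1)) (e : Equiv.Perm (Fin m)), f = i.succAbove ∘ e := by
  have hns : ¬ Function.Surjective f := by
    intro hs
    have := Fintype.card_le_of_surjective f hs
    simp at this
  unfold Function.Surjective at hns
  push Not at hns
  obtain ⟨i, hi⟩ := hns
  have h : ∀ a, ∃ b, i.succAbove b = f a := fun a => Fin.exists_succAbove_eq (hi a)
  choose e he using h
  have hinj : Function.Injective e := by
    intro a b hab
    apply hf
    rw [← he, ← he, hab]
  refine ⟨i, Equiv.ofBijective e (Finite.injective_iff_bijective.1 hinj), ?_⟩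
  funext a
  simp [he]

lemma minorsIdeal_eq {R : Type*} [CommRing R] {m : ℕ}
    (M : Matrix (Fin (m + 1)) (Fin (m + 1)) R) :
    minorsIdeal m M = Ideal.span {d | ∃ i j, d = M.adjugate i j} := by
  apply le_antisymm
  · unfold minorsIdeal
    rw [Ideal.span_le]
    rintro d ⟨f, g, hf, hg, rfl⟩
    obtain ⟨i, e, rfl⟩ := exists_perm_succAbove f hf
    obtain ⟨j, e', rfl⟩ := exists_perm_succAbove g hg
    have h : M.submatrix (i.succAbove ∘ e) (j.succAbove ∘ e') =
        ((M.submatrix i.succAbove j.succAbove).submatrix e id).submatrix id e' := rfl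
    rw [h, Matrix.det_permute', Matrix.det_permute]
    have h2 : (M.submatrix i.succAbove j.succAbove).det =
        (-1) ^ (i + j : ℕ) * M.adjugate j i := by
      rw [Matrix.adjugate_fin_succ_eq_det_submatrix, ← mul_assoc, ← mul_pow]
      simp
    rw [h2]
    refine Ideal.mul_mem_left _ _ (Ideal.mul_mem_left _ _ (Ideal.mul_mem_left _ _ ?_))
    exact Ideal.subset_span ⟨j, i, rfl⟩
  · rw [Ideal.span_le]
    rintro d ⟨i, j, rfl⟩
    rw [Matrix.adjugate_fin_succ_eq_det_submatrix]
    exact Ideal.mul_mem_left _ _ (Ideal.subset_span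
      ⟨_, _, Fin.succAbove_right_injective, Fin.succAbove_right_injective, rfl⟩)

lemma minorsIdeal_adj (hn : 2 ≤ n) :
    minorsIdeal (n - 1) (sparseGenericSym K n G) =
      Ideal.span {d | ∃ i j, d = adj K G i j} := by
  obtain ⟨m, rfl⟩ : ∃ m, n = m + 1 := ⟨n - 1, by omega⟩
  exact minorsIdeal_eq _

lemma initialForm_adj_G (i j : Fin n) :
    initialForm (graphWeight G) (adj K G i j) = adj K G i j := by
  ext m
  rw [coeff_initialForm]
  split_ifs with h
  · rfl
  · by_contra hc
    have hc : coeff m (adj K G i j) ≠ 0 := fun h => hc h.symm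
    apply h
    rw [adj_gw hc, topWeight_eq _ _ ((n - 1) * 2) (fun m hm => (adj_gw hm).le) ⟨m, hc, adj_gw hc⟩]

lemma coeff_adj_pexp (hTG : T ≤ G) (hT : T.IsAcyclic)
    (hspan : ∀ u v : Fin n, T.Reachable u v ↔ G.Reachable u v)
    {i j : Fin n} (p : T.Walk i j) (hp : p.IsPath) :
    coeff (pexp p) (adj K G i j) = (-1) ^ p.length := by
  rw [coeff_adj hTG hT hspan p hp _ le_rfl, if_pos rfl]

lemma sign_ne (k : ℕ) : ((-1 : K)) ^ k ≠ 0 := pow_ne_zero _ (by simp)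

lemma adj_ne_zero (hTG : T ≤ G) (hT : T.IsAcyclic)
    (hspan : ∀ u v : Fin n, T.Reachable u v ↔ G.Reachable u v)
    {i j : Fin n} (p : T.Walk i j) (hp : p.IsPath) : adj K G i j ≠ 0 := by
  intro h
  have := coeff_adj_pexp (K := K) hTG hT hspan p hp
  rw [h, coeff_zero] at this
  exact sign_ne _ this.symm

lemma initialForm_adj (hn : 2 ≤ n) (hTG : T ≤ G) (hT : T.IsAcyclic)
    (hspan : ∀ u v : Fin n, T.Reachable u v ↔ G.Reachable u v)
    {i j : Fin n} (p : T.Walk i j) (hp : p.IsPath) :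
    initialForm (diagWeight n) (initialForm (graphWeight T) (adj K G i j)) =
      monomial (pexp p) ((-1) ^ p.length) := by
  have hc := coeff_adj_pexp (K := K) hTG hT hspan p hp
  have hc0 : coeff (pexp p) (adj K G i j) ≠ 0 := by rw [hc]; exact sign_ne _
  have hg := gw_pexp p hp
  have ht : topWeight (graphWeight T) (adj K G i j) = 2 * (n - 1) := by
    apply topWeight_eq
    · intro m hm
      have := graphWeight_le (T := T) m
      rwa [adj_deg hm] at this
    · exact ⟨pexp p, hc0, by omega⟩
  have hcT : ∀ m, coeff m (initialForm (graphWeight T) (adj K G i j)) =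
      if monWeight (graphWeight T) m = 2 * (n - 1) then coeff m (adj K G i j) else 0 := by
    intro m; rw [coeff_initialForm, ht]
  have hgp : monWeight (graphWeight T) (pexp p) = 2 * (n - 1) := by omega
  have hcp : coeff (pexp p) (initialForm (graphWeight T) (adj K G i j)) = (-1) ^ p.length := by
    rw [hcT, if_pos hgp, hc]
  have key : ∀ m, coeff m (initialForm (graphWeight T) (adj K G i j)) ≠ 0 →
      monWeight (diagWeight n) (pexp p) ≤ monWeight (diagWeight n) m → m = pexp p := by
    intro m hm hle
    rw [hcT] at hm
    split_ifs at hm with hw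
    · have r1 := cw_rel (T := T) m
      have r2 := cw_rel (T := T) (pexp p)
      rw [adj_deg hm, hw] at r1
      rw [adj_deg hc0, hgp] at r2
      by_contra hne
      rw [coeff_adj hTG hT hspan p hp m (by omega), if_neg hne] at hm
      exact hm rfl
    · exact absurd rfl hm
  have htd : topWeight (diagWeight n) (initialForm (graphWeight T) (adj K G i j)) =
      monWeight (diagWeight n) (pexp p) := by
    apply topWeight_eq
    · intro m hm
      by_contra hlt
      have := key m hm (by omega)
      rw [this] at hlt
      exact hlt le_rfl
    · exact ⟨pexp p, by rw [hcp]; exact sign_ne _, rfl⟩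
  ext m
  rw [coeff_initialForm, htd, coeff_monomial]
  by_cases hm : m = pexp p
  · subst hm
    simp [hcp]
  · have hm' : ¬ pexp p = m := fun h => hm h.symm
    rw [if_neg hm']
    split_ifs with hw
    · by_contra h
      exact hm (key m h hw.ge)
    · rfl

lemma monomial_nil (i : Fin n) :
    monomial (pexp (SimpleGraph.Walk.nil : T.Walk i i)) (1 : K) =
      ∏ j ∈ Finset.univ.erase i, X s(j, j) := by
  rw [monomial_pexp]
  simp [pathGenerator, Finset.sdiff_singleton_eq_erase]

lemma monomial_pexp_mem {i j : Fin n} (p : T.Walk i j) (hp : p.IsPath) :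
    monomial (pexp p) (1 : K) ∈ forestIdealZ K n T := by
  by_cases h : i = j
  · subst h
    have : p = SimpleGraph.Walk.nil := SimpleGraph.Walk.isPath_iff_eq_nil.1 hp
    rw [this, monomial_nil]
    exact Ideal.subset_span (Or.inl ⟨i, rfl⟩)
  · rw [monomial_pexp]
    exact Ideal.subset_span (Or.inr ⟨i, j, p, hp, h, rfl⟩)

theorem main (hn : 2 ≤ n) (hTG : T ≤ G) (hT : T.IsAcyclic)
    (hspan : ∀ u v : Fin n, T.Reachable u v ↔ G.Reachable u v) :
    initialIdeal (diagWeight n)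
        (initialIdeal (graphWeight T)
          (initialIdeal (graphWeight G) (minorsIdeal (n - 1) (sparseGenericSym K n G)))) =
      forestIdealZ K n T := by
  rw [minorsIdeal_adj hn]
  apply le_antisymm
  · have hex : ∀ L : LT T, ∃ (a : Fin n × Fin n) (p : T.Walk a.1 a.2),
        p.IsPath ∧ pexp p ≤ L.1 := by
      rintro ⟨L, i, j, p, hp, hL⟩
      exact ⟨(i, j), p, hp, hL⟩
    choose a p hp hpL using hex
    let g : LT T → SymPolyRing K n := fun L =>
      monomial (L.1 - pexp (p L)) (1 : K) * adj K G (a L).1 (a L).2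
    have hgG : (fun L => initialForm (graphWeight G) (g L)) = g := by
      funext L
      simp only [g]
      rw [initialForm_monomial_mul _ _ _ _ one_ne_zero, initialForm_adj_G]
    have hgd : (fun L => initialForm (diagWeight n) (initialForm (graphWeight T) (g L))) =
        fun L : LT T => monomial L.1 ((-1 : K) ^ (p L).length) := by
      funext L
      simp only [g]
      rw [initialForm_monomial_mul _ _ _ _ one_ne_zero,
        initialForm_monomial_mul _ _ _ _ one_ne_zero, initialForm_adj hn hTG hT hspan _ (hp L),
        monomial_mul, tsub_add_cancel_of_le (hpL L), one_mul]
    have li3 : LinearIndependent K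
        (fun L => initialForm (diagWeight n) (initialForm (graphWeight T) (g L))) := by
      rw [hgd]
      have h1 : LinearIndependent K (fun L : LT T => (monomial L.1 (1 : K) : SymPolyRing K n)) := by
        have := (basisMonomials (Sym2 (Fin n)) K).linearIndependent.comp
          (fun L : LT T => L.1) Subtype.val_injective
        simpa [Function.comp_def] using this
      have h2 := h1.units_smul (fun L => (-1 : Kˣ) ^ (p L).length)
      convert h2 using 1
      funext L
      simp [Units.smul_def, smul_monomial]
    have li2 := linearIndependent_of_initialForm _ _ li3
    have li1 : LinearIndependent K (fun L => initialForm (graphWeight G) (g L)) := by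
      rw [hgG]
      exact linearIndependent_of_initialForm _ _ li2
    have h0 : ∀ f ∈ Ideal.span {d | ∃ i j, d = adj K G i j},
        f ∈ Submodule.span K (Set.range g) := by
      have hall := all_mem_span hTG hT hspan (Submodule.span K (Set.range g)) (by
        intro L
        exact ⟨_, _, p L, hp L, hpL L, Submodule.subset_span ⟨L, rfl⟩⟩)
      intro f hf
      suffices H : ∀ q, q * f ∈ Submodule.span K (Set.range g) by simpa using H 1
      induction hf using Submodule.span_induction with
      | mem x hx =>
        obtain ⟨i, j, rfl⟩ := hx
        apply mul_mem_of_monomial_mul_mem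
        intro u
        by_cases hr : G.Reachable i j
        · obtain ⟨q, hq⟩ := exists_path hspan hr
          exact hall u i j q hq
        · rw [adj_eq_zero hr, mul_zero]
          exact Submodule.zero_mem _
      | zero => intro q; rw [mul_zero]; exact Submodule.zero_mem _
      | add x y _ _ hx hy => intro q; rw [mul_add]; exact Submodule.add_mem _ (hx q) (hy q)
      | smul r x _ hx => intro q; rw [smul_eq_mul, ← mul_assoc]; exact hx _
    have h1 := initialIdeal_le _ g li1 _ h0
    rw [hgG] at h1
    have h2 := initialIdeal_le _ g li2 _ h1
    have h3 := initialIdeal_le _ _ li3 _ h2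
    rw [hgd] at h3
    intro f hf
    have hsub : Submodule.span K (Set.range fun L : LT T =>
        (monomial L.1 ((-1 : K) ^ (p L).length) : SymPolyRing K n)) ≤
        (forestIdealZ K n T).restrictScalars K := by
      rw [Submodule.span_le]
      rintro _ ⟨L, rfl⟩
      have : (monomial L.1 ((-1 : K) ^ (p L).length) : SymPolyRing K n) =
          monomial (L.1 - pexp (p L)) ((-1 : K) ^ (p L).length) * monomial (pexp (p L)) 1 := by
        rw [monomial_mul, tsub_add_cancel_of_le (hpL L), mul_one]
      simp only [this]
      exact Ideal.mul_mem_left _ _ (monomial_pexp_mem _ (hp L))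
    exact hsub (h3 f hf)
  · have hmem : ∀ {i j : Fin n} (p : T.Walk i j), p.IsPath → monomial (pexp p) (1 : K) ∈
        initialIdeal (diagWeight n) (initialIdeal (graphWeight T)
          (initialIdeal (graphWeight G) (Ideal.span {d | ∃ i j, d = adj K G i j}))) := by
      intro i j p hp
      have n0 := adj_ne_zero (K := K) hTG hT hspan p hp
      have m0 : adj K G i j ∈ Ideal.span {d | ∃ i j, d = adj K G i j} :=
        Ideal.subset_span ⟨i, j, rfl⟩
      have m1 := initialForm_mem (w := graphWeight G) m0 n0
      rw [initialForm_adj_G] at m1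
      have m2 := initialForm_mem (w := graphWeight T) m1 n0
      have m3 := initialForm_mem (w := diagWeight n) m2 (initialForm_ne_zero _ n0)
      rw [initialForm_adj hn hTG hT hspan p hp] at m3
      have := Ideal.mul_mem_left _ (C ((-1 : K) ^ p.length)) m3
      rwa [C_mul_monomial, ← mul_pow, neg_one_mul, neg_neg, one_pow] at this
    unfold forestIdealZ
    rw [Ideal.span_le]
    rintro m (⟨i, rfl⟩ | ⟨k, l, p, hp, -, rfl⟩)
    · rw [← monomial_nil (T := T) i]
      exact hmem _ SimpleGraph.Walk.IsPath.nil
    · rw [← monomial_pexp]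
      exact hmem p hp

end Final


end SparseSym

/-- For a simple graph `G` on `[n]` and a spanning forest `T` of `G`, the iterated
initial ideal of `I_{n-1}(X_G)` with respect to `w_G`, then `w_T`, then `w_diag` is the
squarefree monomial ideal `I_T|_{Z=0}`. -/
theorem initialIdeal_submaximalMinors_sparse_symmetric
    (K : Type*) [Field K] (n : ℕ) (hn : 2 ≤ n) (G T : SimpleGraph (Fin n))
    (hTG : T ≤ G) (hT : T.IsAcyclic)
    (hspan : ∀ u v : Fin n, T.Reachable u v ↔ G.Reachable u v) :
    initialIdeal (diagWeight n)
        (initialIdeal (graphWeight T)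
          (initialIdeal (graphWeight G) (minorsIdeal (n - 1) (sparseGenericSym K n G)))) =
      forestIdealZ K n T := by
  exact SparseSym.main hn hTG hT hspan
end

section
/- Let K be a field, n ≥ 2, and G a simple graph on [n]. The principal ideal (det(X_G)) ⊆ R generated by the determinant of the sparse generic symmetric matrix X_G is a prime ideal if and only if G is connected. In particular, if G is connected then det(X_G) is an irreducible polynomial in R. -/
open MvPolynomial
open scoped Classical

theorem sgs_map {K : Type*} [Field K] {n : ℕ} (G : SimpleGraph (Fin n)) {S : Type*} [CommRing S]
    (φ : SymPolyRing K n →+* S) :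
    φ (sparseGenericSym K n G).det =
      Matrix.det (fun i j : Fin n => if i = j ∨ G.Adj i j then φ (X s(i, j)) else 0) := by
  rw [RingHom.map_det]
  congr 1
  ext i j
  simp only [RingHom.mapMatrix_apply, Matrix.map_apply, sparseGenericSym]
  split_ifs <;> simp

theorem sgs_map_diag {K : Type*} [Field K] {n : ℕ} (G : SimpleGraph (Fin n)) {S : Type*}
    [CommRing S] (φ : SymPolyRing K n →+* S) (h : ∀ i j, i ≠ j → φ (X s(i, j)) = 0) :
    φ (sparseGenericSym K n G).det = ∏ i, φ (X s(i, i)) := by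
  rw [sgs_map, ← Matrix.det_diagonal]
  congr 1
  ext i j
  by_cases hij : i = j
  · subst hij; simp
  · simp [Matrix.diagonal_apply_ne _ hij, h i j hij]

theorem sgs_ne_zero {K : Type*} [Field K] {n : ℕ} (G : SimpleGraph (Fin n)) :
    (sparseGenericSym K n G).det ≠ 0 := by
  intro h
  have := sgs_map_diag G (eval (fun e : Sym2 (Fin n) => if e.IsDiag then (1 : K) else 0))
    (by intro i j hij; simp [hij])
  simp [h] at this

theorem sgs_degreeOf {K : Type*} [Field K] {n : ℕ} (G : SimpleGraph (Fin n)) (i : Fin n) :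
    (sparseGenericSym K n G).det.degreeOf s(i, i) ≤ 1 := by
  rw [Matrix.det_apply']
  refine (degreeOf_sum_le _ _ _).trans (Finset.sup_le fun σ _ => ?_)
  refine (degreeOf_mul_le _ _ _).trans ?_
  have h1 : degreeOf s(i, i) (((Equiv.Perm.sign σ : ℤ) : SymPolyRing K n)) = 0 := by
    have : ((Equiv.Perm.sign σ : ℤ) : SymPolyRing K n) = C ((Equiv.Perm.sign σ : ℤ) : K) := by simp
    rw [this, degreeOf_C]
  rw [h1, zero_add]
  refine (degreeOf_prod_le _ _ _).trans ?_
  calc _ ≤ ∑ k, (if k = i then 1 else 0) := by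
        refine Finset.sum_le_sum fun k _ => ?_
        unfold sparseGenericSym
        split_ifs with h2 h3 h3
        · rw [degreeOf_X]; split_ifs <;> simp
        · rw [degreeOf_X, if_neg]
          simp only [Sym2.eq_iff]
          tauto
        · simp
        · simp
    _ = 1 := by simp

theorem sgs_totalDegree {K : Type*} [Field K] {n : ℕ} (G : SimpleGraph (Fin n)) :
    (sparseGenericSym K n G).det.totalDegree ≤ n := by
  rw [Matrix.det_apply']
  refine totalDegree_finsetSum_le fun σ _ => ?_
  refine (totalDegree_mul _ _).trans ?_
  have h1 : totalDegree (((Equiv.Perm.sign σ : ℤ) : SymPolyRing K n)) = 0 := by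
    have : ((Equiv.Perm.sign σ : ℤ) : SymPolyRing K n) = C ((Equiv.Perm.sign σ : ℤ) : K) := by simp
    rw [this, totalDegree_C]
  rw [h1, zero_add]
  refine (totalDegree_finsetProd _ _).trans ?_
  calc _ ≤ ∑ k : Fin n, 1 := by
        refine Finset.sum_le_sum fun k _ => ?_
        unfold sparseGenericSym
        split_ifs <;> simp
    _ = n := by simp

/-- If one factor involves no diagonal variable, it is a unit. -/
theorem sgs_unit {K : Type*} [Field K] {n : ℕ} (G : SimpleGraph (Fin n)) (f g : SymPolyRing K n)
    (hfg : (sparseGenericSym K n G).det = f * g) (hg : ∀ i, s(i, i) ∉ g.vars) : IsUnit g := by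
  have hne := sgs_ne_zero (K := K) G
  have hf0 : f ≠ 0 := by rintro rfl; simp [hfg] at hne
  have hg0 : g ≠ 0 := by rintro rfl; simp [hfg] at hne
  set p : Sym2 (Fin n) → Polynomial K := fun e => if e.IsDiag then Polynomial.X else 0 with hp
  have h1 := sgs_map_diag G (aeval (R := K) p : SymPolyRing K n →ₐ[K] Polynomial K).toRingHom
    (by intro i j hij; simp [hp, hij])
  have h2 : aeval p g = Polynomial.C (constantCoeff g) := by
    have := eval₂Hom_eq_constantCoeff_of_vars (algebraMap K (Polynomial K)) (g := p) (p := g) (by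
      intro e he
      induction e with | _ a b =>
      by_cases hab : a = b
      · subst hab; exact absurd he (hg a)
      · simp [hp, hab])
    exact this
  have h3 : aeval p f * Polynomial.C (constantCoeff g) = Polynomial.X ^ n := by
    rw [← h2, ← map_mul, ← hfg]
    simpa [hp] using h1
  have h4 : n ≤ f.totalDegree := by
    have h5 : (aeval p f).natDegree ≤ f.totalDegree * 1 :=
      MvPolynomial.aeval_natDegree_le f le_rfl p (fun i => by
        simp only [hp]; split_ifs <;> simp)
    have h6 := congrArg Polynomial.natDegree h3
    rw [Polynomial.natDegree_X_pow] at h6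
    have h7 := Polynomial.natDegree_mul_C_le (aeval p f) (constantCoeff g)
    omega
  have h8 := sgs_totalDegree (K := K) G
  rw [hfg, totalDegree_mul_of_isDomain hf0 hg0] at h8
  have h9 : g.totalDegree = 0 := by omega
  rw [totalDegree_eq_zero_iff_eq_C] at h9
  rw [h9] at hg0 ⊢
  refine IsUnit.map C (isUnit_iff_ne_zero.2 ?_)
  rintro h
  simp [h] at hg0

/-- The evaluation point attached to an edge. -/
def sgsPt (K : Type*) [Field K] {n : ℕ} (i j : Fin n) (u v : K) : Sym2 (Fin n) → K := fun e =>
  if e = s(i, i) then u else if e = s(j, j) then v else if e = s(i, j) then 1 else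
    if e.IsDiag then 1 else 0

theorem sgs_eval {K : Type*} [Field K] {n : ℕ} (G : SimpleGraph (Fin n)) {i j : Fin n}
    (hij : G.Adj i j) (u v : K) :
    (eval (sgsPt K i j u v) (sparseGenericSym K n G).det = 0) ↔ u * v = 1 := by
  have hne := hij.ne
  have hM := sgs_map G (eval (sgsPt K i j u v))
  have hM2 : (fun k l : Fin n => if k = l ∨ G.Adj k l then eval (sgsPt K i j u v) (X s(k, l)) else 0)
    = (1 + Matrix.single i i (u - 1) + Matrix.single j j (v - 1) + Matrix.single i j 1
        + Matrix.single j i 1 : Matrix (Fin n) (Fin n) K) := by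
    ext k l
    simp only [sgsPt, eval_X, Sym2.eq_iff, Matrix.add_apply, Matrix.one_apply, Matrix.single_apply,
      Sym2.mk_isDiag_iff]
    by_cases hki : k = i <;> by_cases hkj : k = j <;> by_cases hli : l = i <;>
      by_cases hlj : l = j <;> by_cases hkl : k = l <;> 
      simp_all [eq_comm, G.adj_comm]
  rw [hM, hM2, ← Matrix.exists_mulVec_eq_zero_iff]
  have key : ∀ (w : Fin n → K) (k : Fin n), ((1 + Matrix.single i i (u - 1) + Matrix.single j j (v - 1)
      + Matrix.single i j 1 + Matrix.single j i 1 : Matrix (Fin n) (Fin n) K).mulVec w) k =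
      w k + (if k = i then (u - 1) * w i + w j else 0) + 
        (if k = j then (v - 1) * w j + w i else 0) := by
    intro w k
    simp only [Matrix.add_mulVec, Matrix.one_mulVec, Matrix.single_mulVec, Pi.add_apply,
      Function.update_apply, Pi.zero_apply]
    split_ifs <;> ring
  constructor
  · rintro ⟨w, hw0, hw⟩
    by_contra huv
    apply hw0
    have e1 := congrFun hw i
    have e2 := congrFun hw j
    rw [key] at e1 e2
    simp [hne, hne.symm] at e1 e2
    have e3 : (u * v - 1) * w i = 0 := by linear_combination v * e1 - e2
    have e4 : (u * v - 1) * w j = 0 := by linear_combination u * e2 - e1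
    have e5 : u * v - 1 ≠ 0 := sub_ne_zero.2 huv
    have e6 := (mul_eq_zero.1 e3).resolve_left e5
    have e7 := (mul_eq_zero.1 e4).resolve_left e5
    ext k
    have e8 := congrFun hw k
    rw [key] at e8
    simpa [e6, e7] using e8
  · intro huv
    refine ⟨fun k => if k = i then 1 else if k = j then -u else 0, ?_, ?_⟩
    · intro h
      simpa using congrFun h i
    · ext k
      rw [key]
      by_cases hki : k = i
      · subst hki; simp [hne, hne.symm]; ring
      · by_cases hkj : k = j
        · subst hkj; simp [hne, hne.symm]; linear_combination -huv
        · simp [hki, hkj]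

theorem sgs_eval_congr {K : Type*} [Field K] {n : ℕ} (f : SymPolyRing K n)
    (p q : Sym2 (Fin n) → K) (h : ∀ e ∈ f.vars, p e = q e) : eval p f = eval q f :=
  eval₂Hom_congr' rfl (fun e he _ => h e he) rfl

theorem sgs_irreducible {K : Type*} [Field K] {n : ℕ} (hn : 2 ≤ n) (G : SimpleGraph (Fin n))
    (hG : G.Connected) : Irreducible (sparseGenericSym K n G).det := by
  have hne := sgs_ne_zero (K := K) G
  refine ⟨?_, ?_⟩
  · intro hu
    have h1 := hu.map (eval (fun _ : Sym2 (Fin n) => (0 : K)))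
    rw [sgs_map_diag G _ (by simp)] at h1
    simp at h1
    omega
  intro f g hfg
  have hf0 : f ≠ 0 := by rintro rfl; simp [hfg] at hne
  have hg0 : g ≠ 0 := by rintro rfl; simp [hfg] at hne
  have hsplit : ∀ i, s(i, i) ∈ f.vars → s(i, i) ∉ g.vars := by
    intro i h1 h2
    rw [mem_vars_iff_degreeOf_ne_zero] at h1 h2
    have h3 := sgs_degreeOf (K := K) G i
    rw [hfg, degreeOf_mul_eq hf0 hg0] at h3
    omega
  by_cases hT : ∀ i, s(i, i) ∉ g.vars
  · exact Or.inr (sgs_unit G f g hfg hT)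
  by_cases hS : ∀ i, s(i, i) ∉ f.vars
  · exact Or.inl (sgs_unit G g f (by rw [hfg, mul_comm]) hS)
  exfalso
  push Not at hT hS
  obtain ⟨b, hb⟩ := hT
  obtain ⟨a, ha⟩ := hS
  obtain ⟨w⟩ := hG.preconnected b a
  obtain ⟨d, -, hd1, hd2⟩ := w.exists_boundary_dart {k | s(k, k) ∈ g.vars} hb
    (hsplit a ha)
  have hd3 : s(d.fst, d.fst) ∉ f.vars := fun h => hsplit _ h hd1
  have hadj := d.adj
  simp only [Set.mem_ofPred_eq] at hd1 hd2
  generalize d.fst = i at *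
  generalize d.snd = j at *
  -- `f` does not see `x_ii`, `g` does not see `x_jj`
  have hf : ∀ u u' v, eval (sgsPt K i j u v) f = eval (sgsPt K i j u' v) f := by
    intro u u' v
    refine sgs_eval_congr _ _ _ fun e he => ?_
    have : e ≠ s(i, i) := by rintro rfl; exact hd3 he
    simp [sgsPt, this]
  have hg : ∀ u v v', eval (sgsPt K i j u v) g = eval (sgsPt K i j u v') g := by
    intro u v v'
    refine sgs_eval_congr _ _ _ fun e he => ?_
    have : e ≠ s(j, j) := by rintro rfl; exact hd2 he
    simp [sgsPt, this]
  have h11 := (sgs_eval (K := K) G hadj 1 1).2 (by simp)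
  have h10 := (sgs_eval (K := K) G hadj 1 0).not.2 (by simp)
  have h01 := (sgs_eval (K := K) G hadj 0 1).not.2 (by simp)
  rw [hfg, map_mul] at h11 h10 h01
  rw [hf 0 1 1] at h01
  rw [hg 1 0 1] at h10
  rcases mul_eq_zero.1 h11 with h | h
  · exact h01 (by rw [h, zero_mul])
  · exact h10 (by rw [h, mul_zero])

theorem sgs_block_not_unit {K : Type*} [Field K] {n : ℕ} (G : SimpleGraph (Fin n))
    (p : Fin n → Prop) [Fintype {k // p k}] (a : Fin n) (ha : p a) :
    ¬ IsUnit (Matrix.toSquareBlockProp (sparseGenericSym K n G) p).det := by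
  intro hu
  have h1 := hu.map (eval (fun _ : Sym2 (Fin n) => (0 : K)))
  rw [RingHom.map_det, Matrix.det_eq_zero_of_row_eq_zero ⟨a, ha⟩] at h1
  · simp at h1
  · intro j
    simp only [RingHom.mapMatrix_apply, Matrix.map_apply, Matrix.toSquareBlockProp_def,
      sparseGenericSym, Matrix.of_apply]
    split_ifs <;> simp

theorem sgs_connected {K : Type*} [Field K] {n : ℕ} (hn : 2 ≤ n) (G : SimpleGraph (Fin n))
    (h : Irreducible (sparseGenericSym K n G).det) : G.Connected := by
  haveI : Nonempty (Fin n) := ⟨⟨0, by omega⟩⟩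
  refine SimpleGraph.Connected.mk fun a b => ?_
  by_contra hab
  have hdet := Matrix.twoBlockTriangular_det (sparseGenericSym K n G) (fun k => G.Reachable a k) (by
    intro i hi j hj
    unfold sparseGenericSym
    rw [if_neg]
    rintro (rfl | hadj)
    · exact hi hj
    · exact hi (hj.trans hadj.symm.reachable))
  rcases h.isUnit_or_isUnit hdet with h1 | h1
  · exact sgs_block_not_unit G _ a (SimpleGraph.Reachable.refl a) h1
  · exact sgs_block_not_unit G (fun k => ¬ G.Reachable a k) b hab h1

/-- The principal ideal generated by the determinant of the sparse generic symmetric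
matrix `X_G` is prime if and only if `G` is connected; in particular, if `G` is connected
then `det(X_G)` is an irreducible polynomial. -/
theorem det_sparse_symmetric_prime_iff_connected
    (K : Type*) [Field K] (n : ℕ) (hn : 2 ≤ n) (G : SimpleGraph (Fin n)) :
    ((Ideal.span {(sparseGenericSym K n G).det}).IsPrime ↔ G.Connected) ∧
    (G.Connected → Irreducible (sparseGenericSym K n G).det) := by
  have hne := sgs_ne_zero (K := K) G
  refine ⟨?_, sgs_irreducible hn G⟩
  rw [Ideal.span_singleton_prime hne, ← irreducible_iff_prime]
  exact ⟨sgs_connected hn G, sgs_irreducible hn G⟩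
end

section
/- Let T be a spanning tree on the vertex set [n] (so every pair of vertices is joined by a path in T). Then the squarefree monomial ideal I_T ⊆ R, generated by the monomials (x_{11}⋯x_{nn})/x_{ii} for i = 1,…,n together with the monomials (∏_{i ∈ [n]∖V(p)} x_{ii})·x_p for all paths p in T, has height 3. -/
open MvPolynomial
open scoped Classical

/-- The height of an ideal `I` in a commutative ring: the infimum, over all prime ideals
`p` containing `I`, of the height of `p` (the height of a prime being the supremum of the
lengths of chains of primes descending from it, i.e. its height as a point of the prime
spectrum ordered by inclusion). -/
noncomputable def idealHeight {R : Type*} [CommRing R] (I : Ideal R) : ℕ∞ :=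
  ⨅ p ∈ {p : PrimeSpectrum R | I ≤ p.asIdeal}, Order.height p

/-- The ideal generated by the variables in `s` is the kernel of the map killing them. -/
theorem TH.span_eq_ker {K σ : Type*} [Field K] (s : Set σ) :
    Ideal.span ((X : σ → MvPolynomial σ K) '' s) =
      RingHom.ker (aeval (R := K) (fun i => if i ∈ s then (0 : MvPolynomial σ K) else X i)) := by
  apply le_antisymm
  · rw [Ideal.span_le]
    rintro _ ⟨i, hi, rfl⟩
    simp [RingHom.mem_ker, hi]
  · intro p hp
    rw [RingHom.mem_ker] at hp
    have key : (Ideal.Quotient.mkₐ K (Ideal.span ((X : σ → MvPolynomial σ K) '' s))).comp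
        (aeval (R := K) (fun i => if i ∈ s then (0 : MvPolynomial σ K) else X i)) =
        Ideal.Quotient.mkₐ K (Ideal.span ((X : σ → MvPolynomial σ K) '' s)) := by
      apply MvPolynomial.algHom_ext
      intro i
      by_cases hi : i ∈ s
      · simp only [AlgHom.comp_apply, aeval_X, hi, if_true, map_zero]
        symm
        exact Ideal.Quotient.eq_zero_iff_mem.mpr (Ideal.subset_span ⟨i, hi, rfl⟩)
      · simp [hi]
    have h2 := congrArg (fun f => f p) key
    simp only [AlgHom.comp_apply, hp, map_zero] at h2
    exact Ideal.Quotient.eq_zero_iff_mem.mp h2.symm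

theorem TH.isPrime {K σ : Type*} [Field K] (s : Set σ) :
    (Ideal.span ((X : σ → MvPolynomial σ K) '' s)).IsPrime := by
  rw [TH.span_eq_ker]
  exact RingHom.ker_isPrime _

theorem TH.notMem {K σ : Type*} [Field K] (s : Set σ) (c : σ) (hc : c ∉ s) :
    (X c : MvPolynomial σ K) ∉ Ideal.span ((X : σ → MvPolynomial σ K) '' s) := by
  rw [TH.span_eq_ker, RingHom.mem_ker]
  simp [hc]

theorem TH.height_insert {K σ : Type*} [Field K] (s : Set σ) (c : σ) (hc : c ∉ s) :
    (Ideal.span ((X : σ → MvPolynomial σ K) '' s)).height + 1 ≤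
      (Ideal.span ((X : σ → MvPolynomial σ K) '' (insert c s))).height := by
  haveI := TH.isPrime (K := K) s
  haveI := TH.isPrime (K := K) (insert c s)
  apply Ideal.height_add_one_le_of_lt_of_isPrime
  refine lt_of_le_of_ne (Ideal.span_mono (Set.image_mono (Set.subset_insert _ _))) ?_
  intro h
  apply TH.notMem (K := K) s c hc
  rw [h]
  exact Ideal.subset_span ⟨c, Set.mem_insert _ _, rfl⟩

theorem TH.three_le {K σ : Type*} [Field K] (P : Ideal (MvPolynomial σ K))
    (a b c : σ) (hab : a ≠ b) (hac : a ≠ c) (hbc : b ≠ c)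
    (ha : X a ∈ P) (hb : X b ∈ P) (hc : X c ∈ P) : 3 ≤ P.height := by
  have h1 := TH.height_insert (K := K) ∅ a (by simp)
  have h2 := TH.height_insert (K := K) (insert a ∅) b (by simp [hab.symm])
  have h3 := TH.height_insert (K := K) (insert b (insert a ∅)) c (by simp [hac.symm, hbc.symm])
  have h4 : Ideal.span ((X : σ → MvPolynomial σ K) '' (insert c (insert b (insert a ∅)))) ≤ P := by
    rw [Ideal.span_le]
    rintro _ ⟨i, hi, rfl⟩
    simp only [Set.mem_insert_iff, Set.mem_empty_iff_false, or_false] at hi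
    rcases hi with rfl | rfl | rfl <;> assumption
  refine le_trans ?_ (h3.trans (Ideal.height_mono h4))
  calc (3 : ℕ∞) = 0 + 1 + 1 + 1 := by norm_num
    _ ≤ _ := by
      gcongr
      refine le_trans ?_ h2
      gcongr
      refine le_trans ?_ h1
      gcongr
      exact zero_le

theorem TH.le_three {K σ : Type*} [Field K] [Finite σ] (a b c : σ) :
    (Ideal.span ((X : σ → MvPolynomial σ K) '' {a, b, c})).height ≤ 3 := by
  haveI := TH.isPrime (K := K) ({a, b, c} : Set σ)
  have h := Ideal.height_le_card_of_mem_minimalPrimes_span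
    (p := Ideal.span ((X : σ → MvPolynomial σ K) '' {a, b, c}))
    (s := (X : σ → MvPolynomial σ K) '' {a, b, c}) (Set.toFinite _)
    (by rw [Ideal.minimalPrimes_eq_subsingleton_self]; rfl)
  refine h.trans ?_
  have h2 : ((X : σ → MvPolynomial σ K) '' {a, b, c}).ncard ≤ 3 := by
    refine (Set.ncard_image_le (Set.toFinite _)).trans ?_
    refine (Set.ncard_insert_le _ _).trans ?_
    have := Set.ncard_insert_le b ({c} : Set σ)
    rw [Set.ncard_singleton] at this
    omega
  exact_mod_cast h2

theorem TH.bridge {V : Type*} (T : SimpleGraph V) (hT : T.IsAcyclic) {k l u v : V}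
    (hkl : T.Adj k l) (p : T.Walk u v) (hk : k ∈ p.support) (hl : l ∈ p.support) :
    s(k, l) ∈ p.edges := by
  have hb := SimpleGraph.isAcyclic_iff_forall_adj_isBridge.mp hT hkl
  rw [SimpleGraph.isBridge_iff_forall_walk_mem_edges] at hb
  have h := hb ((p.takeUntil k hk).reverse.append (p.takeUntil l hl))
  rw [SimpleGraph.Walk.edges_append, SimpleGraph.Walk.edges_reverse, List.mem_append,
    List.mem_reverse] at h
  rcases h with h | h
  · exact p.edges_takeUntil_subset_edges hk h
  · exact p.edges_takeUntil_subset_edges hl h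

/-- For a spanning tree `T` on `[n]`, the squarefree monomial ideal `I_T`, generated by
the monomials `(x_{11}⋯x_{nn})/x_{ii}` for `i = 1,…,n` together with the monomials
`(∏_{i ∈ [n]∖V(p)} x_{ii}) · x_p` for all paths `p` in `T` (a path having at least one
edge and no repeated vertex), has height `3`. -/
theorem height_treeIdeal
    (K : Type*) [Field K] (n : ℕ) (hn : 2 ≤ n) (T : SimpleGraph (Fin n))
    (hT : T.IsTree) :
    idealHeight (Ideal.span { m : SymPolyRing K n |
      (∃ i : Fin n, m = ∏ j ∈ Finset.univ.erase i, MvPolynomial.X s(j, j)) ∨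
      (∃ (k l : Fin n) (p : T.Walk k l), p.IsPath ∧ k ≠ l ∧ m = pathGenerator p) }) = 3 := by
  unfold idealHeight
  apply le_antisymm
  · haveI : Nontrivial (Fin n) := Fin.nontrivial_iff_two_le.mpr hn
    obtain ⟨k, l, hkl⟩ : ∃ k l, T.Adj k l := by
      obtain ⟨l, h⟩ := hT.1.preconnected.exists_adj_of_nontrivial (⟨0, by omega⟩ : Fin n)
      exact ⟨_, l, h⟩
    have hne := hkl.ne
    have hP := TH.isPrime (K := K) ({s(k, k), s(l, l), s(k, l)} : Set (Sym2 (Fin n)))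
    have hle := TH.le_three (K := K) s(k, k) s(l, l) s(k, l)
    set P := Ideal.span ((X : Sym2 (Fin n) → SymPolyRing K n) '' {s(k, k), s(l, l), s(k, l)})
      with hPdef
    have hk : X s(k, k) ∈ P := Ideal.subset_span ⟨_, by simp, rfl⟩
    have hl : X s(l, l) ∈ P := Ideal.subset_span ⟨_, by simp, rfl⟩
    have he : X s(k, l) ∈ P := Ideal.subset_span ⟨_, by simp, rfl⟩
    refine (iInf₂_le (⟨P, hP⟩ : PrimeSpectrum (SymPolyRing K n)) ?_).trans ?_
    · change Ideal.span _ ≤ P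
      rw [Ideal.span_le]
      rintro m (⟨i, rfl⟩ | ⟨u, v, p, hp, huv, rfl⟩)
      · by_cases hi : i = k
        · subst hi
          exact Ideal.prod_mem (i := l) _ (by simp [hne.symm]) hl
        · exact Ideal.prod_mem (i := k) _ (by simp [Ne.symm hi]) hk
      · unfold pathGenerator
        by_cases h1 : k ∈ p.support
        · by_cases h2 : l ∈ p.support
          · apply Ideal.mul_mem_left
            exact P.mem_of_dvd (List.dvd_prod
              (List.mem_map.mpr ⟨_, TH.bridge T hT.isAcyclic hkl p h1 h2, rfl⟩)) he
          · exact Ideal.mul_mem_right _ _ (Ideal.prod_mem (i := l) _ (by simp [h2]) hl)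
        · exact Ideal.mul_mem_right _ _ (Ideal.prod_mem (i := k) _ (by simp [h1]) hk)
    · rw [← PrimeSpectrum.height_eq_orderHeight]
      exact hle
  · refine le_iInf₂ fun P hP => ?_
    rw [← PrimeSpectrum.height_eq_orderHeight]
    change Ideal.span _ ≤ P.asIdeal at hP
    rw [Ideal.span_le] at hP
    have hprime := P.isPrime
    have hd : ∀ i : Fin n, ∃ j, j ≠ i ∧ (X s(j, j) : SymPolyRing K n) ∈ P.asIdeal := by
      intro i
      have := hP (Or.inl ⟨i, rfl⟩)
      obtain ⟨j, hj, hj'⟩ := (hprime.prod_mem_iff).mp this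
      exact ⟨j, by simpa using hj, hj'⟩
    obtain ⟨k, -, hk⟩ := hd ⟨0, by omega⟩
    obtain ⟨l, hlk, hl⟩ := hd k
    obtain ⟨p, hp⟩ := (hT.1.preconnected k l).exists_isPath
    have hm := hP (Or.inr ⟨k, l, p, hp, hlk.symm, rfl⟩)
    unfold pathGenerator at hm
    have hdiag : ∀ a b : Fin n, a ≠ b → s(a, a) ≠ s(b, b) := by
      intro a b hab h
      simp at h
      exact hab h
    rcases hprime.mem_or_mem hm with h | h
    · obtain ⟨i, hi, hi'⟩ := (hprime.prod_mem_iff).mp h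
      simp only [Finset.mem_sdiff, Finset.mem_univ, true_and, List.mem_toFinset] at hi
      have hik : k ≠ i := by rintro rfl; exact hi p.start_mem_support
      have hil : l ≠ i := by rintro rfl; exact hi p.end_mem_support
      exact TH.three_le _ _ _ _ (hdiag _ _ hlk.symm) (hdiag _ _ hik) (hdiag _ _ hil) hk hl hi'
    · obtain ⟨e, he, he'⟩ : ∃ e ∈ p.edges, (X e : SymPolyRing K n) ∈ P.asIdeal := by
        by_contra! hcon
        have : ∀ L : List (Sym2 (Fin n)), (∀ e ∈ L, (X e : SymPolyRing K n) ∉ P.asIdeal) →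
            (L.map fun e => (X e : SymPolyRing K n)).prod ∉ P.asIdeal := by
          intro L
          induction L with
          | nil =>
            intro _ h1
            exact hprime.ne_top ((Ideal.eq_top_iff_one _).mpr (by simpa using h1))
          | cons a L ih =>
            intro hL h1
            rw [List.map_cons, List.prod_cons] at h1
            rcases hprime.mem_or_mem h1 with h2 | h2
            · exact hL a (by simp) h2
            · exact ih (fun e he => hL e (by simp [he])) h2
        exact this _ hcon h
      have hea : ∀ a : Fin n, s(a, a) ≠ e := by
        rintro a rfl
        exact T.loopless.irrefl a (p.edges_subset_edgeSet he)
      exact TH.three_le _ _ _ _ (hdiag _ _ hlk.symm) (hea k) (hea l) hk hl he'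
end
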